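/- arXiv:1403.3042 — 2 statements merged into one kernel-verified Lean document; each statement's English description precedes it below -/
import Mathlib

section
/- Let M be a κ-combinatorial model category (κ a regular cardinal). Then every trivial cofibration in M is a κ-directed colimit, taken in the arrow category M^→, of trivial cofibrations between κ-presentable objects. -/
open CategoryTheory CategoryTheory.Limits

universe w v u

namespace PaperAcc

/-- A category `J` is `κ`-filtered if every diagram indexed by a category with fewer than `κ`
arrows admits a cocone. -/
def IsCardinalFiltered (J : Type v) [Category.{v} J] (κ : Cardinal.{v}) : Prop :=
  ∀ (A : Type v) [SmallCategory A], Cardinal.mk (Arrow A) < κ →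
    ∀ F : A ⥤ J, Nonempty (Cocone F)

/-- A preorder `P` is `κ`-directed if every subset of cardinality `< κ` has an upper bound. -/
def IsCardinalDirected (P : Type v) [Preorder P] (κ : Cardinal.{v}) : Prop :=
  ∀ S : Set P, Cardinal.mk S < κ → ∃ p : P, ∀ s ∈ S, s ≤ p

/-- An object `X` is `κ`-presentable if `Hom(X, -)` preserves `κ`-filtered colimits. -/
def IsPresentable {M : Type u} [Category.{v} M] (κ : Cardinal.{v}) (X : M) : Prop :=
  ∀ (J : Type v) [SmallCategory J], IsCardinalFiltered J κ →
    Nonempty (PreservesColimitsOfShape J (coyoneda.obj (Opposite.op X)))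

/-- A presentation of `X` as a `κ`-filtered colimit of objects belonging to `P`. -/
structure FilteredColimitPresentation {M : Type u} [Category.{v} M] (κ : Cardinal.{v})
    (P : Set M) (X : M) where
  J : Type v
  [instJ : SmallCategory J]
  filtered : IsCardinalFiltered J κ
  F : J ⥤ M
  mem : ∀ j, F.obj j ∈ P
  c : Cocone F
  isColimit : IsColimit c
  iso : c.pt ≅ X

/-- A presentation of `X` as a `κ`-directed colimit of objects belonging to `P`. -/
structure DirectedColimitPresentation {M : Type u} [Category.{v} M] (κ : Cardinal.{v})
    (P : Set M) (X : M) where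
  J : Type v
  [instJ : Preorder J]
  directed : IsCardinalDirected J κ
  F : J ⥤ M
  mem : ∀ j, F.obj j ∈ P
  c : Cocone F
  isColimit : IsColimit c
  iso : c.pt ≅ X

/-- A class of arrows (viewed as a full subcategory of the arrow category) is closed under
`κ`-filtered colimits. -/
def ClosedUnderFilteredColimits {M : Type u} [Category.{v} M] (κ : Cardinal.{v})
    (P : Set (Arrow M)) : Prop :=
  ∀ (J : Type v) [SmallCategory J], IsCardinalFiltered J κ →
    ∀ (F : J ⥤ Arrow M) (c : Cocone F), IsColimit c → (∀ j, F.obj j ∈ P) → c.pt ∈ P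

/-- The morphisms having the right lifting property with respect to every member of the
family `f`. -/
def RlpOf {M : Type u} [Category.{v} M] {ι : Type w} {A B : ι → M}
    (f : ∀ i, A i ⟶ B i) : MorphismProperty M :=
  fun _ _ g => ∀ i, HasLiftingProperty (f i) g

/-- The morphisms having the left lifting property with respect to every morphism in `P`. -/
def Llp {M : Type u} [Category.{v} M] (P : MorphismProperty M) : MorphismProperty M :=
  fun _ _ g => ∀ ⦃X Y : M⦄ (p : X ⟶ Y), P p → HasLiftingProperty g p

/-- The class `C` is cofibrantly generated by a set of morphisms between `κ`-presentable
objects: `C = llp(rlp(I))` for such a set `I`. -/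
def CofibrantlyGeneratedByPresentables {M : Type u} [Category.{v} M] (κ : Cardinal.{v})
    (C : MorphismProperty M) : Prop :=
  ∃ (ι : Type v) (A B : ι → M) (f : ∀ i, A i ⟶ B i),
    (∀ i, IsPresentable κ (A i)) ∧ (∀ i, IsPresentable κ (B i)) ∧
      C = Llp (RlpOf f)

/-- A category is locally `κ`-presentable: it is cocomplete and has a set of `κ`-presentable
objects such that every object is a `κ`-filtered colimit of objects from this set. -/
def IsLocallyPresentable (M : Type u) [Category.{v} M] (κ : Cardinal.{v}) : Prop :=
  HasColimits M ∧
    ∃ (ι : Type v) (G : ι → M), (∀ i, IsPresentable κ (G i)) ∧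
      ∀ X : M, Nonempty (FilteredColimitPresentation κ (Set.range G) X)

/-- A class of morphisms is stable under retracts (in the arrow category). -/
def IsStableUnderRetracts {M : Type u} [Category.{v} M] (P : MorphismProperty M) : Prop :=
  ∀ {X Y X' Y' : M} (f : X ⟶ Y) (g : X' ⟶ Y') (iX : X ⟶ X') (rX : X' ⟶ X)
    (iY : Y ⟶ Y') (rY : Y' ⟶ Y), iX ≫ rX = 𝟙 X → iY ≫ rY = 𝟙 Y →
    iX ≫ g = f ≫ iY → rX ≫ f = g ≫ rY → P g → P f

/-- A model structure on a category: classes of weak equivalences, cofibrations and fibrations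
satisfying the axioms of a (closed) model category. -/
structure ModelStructure (M : Type u) [Category.{v} M] where
  W : MorphismProperty M
  Cof : MorphismProperty M
  Fib : MorphismProperty M
  W_id : ∀ X : M, W (𝟙 X)
  W_comp : ∀ {X Y Z : M} (f : X ⟶ Y) (g : Y ⟶ Z), W f → W g → W (f ≫ g)
  W_of_comp_right : ∀ {X Y Z : M} (f : X ⟶ Y) (g : Y ⟶ Z), W g → W (f ≫ g) → W f
  W_of_comp_left : ∀ {X Y Z : M} (f : X ⟶ Y) (g : Y ⟶ Z), W f → W (f ≫ g) → W g
  W_retract : IsStableUnderRetracts W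
  Cof_retract : IsStableUnderRetracts Cof
  Fib_retract : IsStableUnderRetracts Fib
  lift_trivCof_fib : ∀ {A B X Y : M} (i : A ⟶ B) (p : X ⟶ Y),
    Cof i → W i → Fib p → HasLiftingProperty i p
  lift_cof_trivFib : ∀ {A B X Y : M} (i : A ⟶ B) (p : X ⟶ Y),
    Cof i → Fib p → W p → HasLiftingProperty i p
  fact_cof_trivFib : ∀ {X Y : M} (f : X ⟶ Y),
    ∃ (Z : M) (i : X ⟶ Z) (p : Z ⟶ Y), Cof i ∧ Fib p ∧ W p ∧ i ≫ p = f
  fact_trivCof_fib : ∀ {X Y : M} (f : X ⟶ Y),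
    ∃ (Z : M) (i : X ⟶ Z) (p : Z ⟶ Y), Cof i ∧ W i ∧ Fib p ∧ i ≫ p = f

/-- A model structure is `κ`-combinatorial if the underlying category is locally
`κ`-presentable and both cofibrations and trivial cofibrations are cofibrantly generated
by sets of morphisms between `κ`-presentable objects. -/
structure IsCombinatorial {M : Type u} [Category.{v} M] (S : ModelStructure M)
    (κ : Cardinal.{v}) : Prop where
  isRegular : κ.IsRegular
  locallyPresentable : IsLocallyPresentable M κ
  cofGenerated : CofibrantlyGeneratedByPresentables κ S.Cof
  trivCofGenerated : CofibrantlyGeneratedByPresentables κ (S.Cof ⊓ S.W)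

/-- An object is cofibrant if the morphism from an(y) initial object to it is a cofibration. -/
def Cofibrant {M : Type u} [Category.{v} M] (S : ModelStructure M) (X : M) : Prop :=
  ∀ ⦃O : M⦄, IsInitial O → ∀ f : O ⟶ X, S.Cof f

/-- A cylinder object for `X`: a factorization `X ⊔ X → C → X` of the codiagonal into
a cofibration followed by a weak equivalence. -/
structure CylinderObject {M : Type u} [Category.{v} M] (S : ModelStructure M) (X : M) where
  C : M
  i₀ : X ⟶ C
  i₁ : X ⟶ C
  p : C ⟶ X
  hi₀ : i₀ ≫ p = 𝟙 X
  hi₁ : i₁ ≫ p = 𝟙 X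
  hp : S.W p
  hcof : ∀ (c : BinaryCofan X X) (hc : IsColimit c), S.Cof (hc.desc (BinaryCofan.mk i₀ i₁))

/-- A commutative square on `(f, g, h, k)` (with `f : A ⟶ B`, `g : A ⟶ X`, `h : B ⟶ Y`,
`k : X ⟶ Y`) is a homotopy pushout: for some (equivalently, any) replacement of the span
`B ← A → X` by a span of cofibrations between cofibrant objects which is weakly equivalent
to it, the comparison morphism from the (strict) pushout of the replacement to `Y` is a
weak equivalence. -/
def IsHomotopyPushout {M : Type u} [Category.{v} M] (S : ModelStructure M)
    {A B X Y : M} (f : A ⟶ B) (g : A ⟶ X) (h : B ⟶ Y) (k : X ⟶ Y) : Prop :=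
  ∃ (A' B' X' P : M) (wA : A' ⟶ A) (i : A' ⟶ B') (wB : B' ⟶ B)
    (j : A' ⟶ X') (wX : X' ⟶ X) (pB : B' ⟶ P) (pX : X' ⟶ P) (m : P ⟶ Y),
      Cofibrant S A' ∧ S.W wA ∧ S.Cof i ∧ S.W wB ∧ S.Cof j ∧ S.W wX ∧
      i ≫ wB = wA ≫ f ∧ j ≫ wX = wA ≫ g ∧
      IsPushout i j pB pX ∧ pB ≫ m = wB ≫ h ∧ pX ≫ m = wX ≫ k ∧ S.W m

/-- A morphism `i : A ⟶ B` is a formal cofibration if every pushout square of `i` along a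
morphism `f : A ⟶ X` with `X` cofibrant is a homotopy pushout. -/
def IsFormalCofibration {M : Type u} [Category.{v} M] (S : ModelStructure M)
    {A B : M} (i : A ⟶ B) : Prop :=
  ∀ {X Y : M} (f : A ⟶ X) (g : B ⟶ Y) (k : X ⟶ Y),
    Cofibrant S X → IsPushout i f g k → IsHomotopyPushout S i f g k

/-- The set of arrows satisfying `P` whose domain and codomain are `κ`-presentable. -/
def PresentableArrowsIn {M : Type u} [Category.{v} M] (κ : Cardinal.{v})
    (P : Set (Arrow M)) : Set (Arrow M) :=
  {a | a ∈ P ∧ IsPresentable κ a.left ∧ IsPresentable κ a.right}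

end PaperAcc

namespace CategoryTheory

section FactorsThrough

variable {C : Type u} [Category.{v} C]

/-- Every morphism to `X` from a `κ`-presentable object factors through a `κ`-presentable
object satisfying `Q`. -/
def ObjectProperty.FactorsThrough (Q : ObjectProperty C) (κ : Cardinal.{v}) [Fact κ.IsRegular]
    (X : C) : Prop :=
  ∀ ⦃A : C⦄, IsCardinalPresentable A κ → ∀ φ : A ⟶ X,
    ∃ (B : C) (_ : Q B) (_ : IsCardinalPresentable B κ) (α : A ⟶ B) (β : B ⟶ X), α ≫ β = φ

namespace ObjectProperty.FactorsThrough

variable {Q : ObjectProperty C} {κ : Cardinal.{v}} [Fact κ.IsRegular]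

lemma of_prop {X : C} (hX : Q X) (hX' : IsCardinalPresentable X κ) : Q.FactorsThrough κ X :=
  fun _ _ φ ↦ ⟨X, hX, hX', φ, 𝟙 X, by simp⟩

lemma of_retract {X Y : C} (r : Retract X Y) (hY : Q.FactorsThrough κ Y) :
    Q.FactorsThrough κ X := fun A hA φ ↦ by
  obtain ⟨B, hB, hB', α, β, h⟩ := hY hA (φ ≫ r.i)
  exact ⟨B, hB, hB', α, β ≫ r.r, by simp [reassoc_of% h]⟩

/-- An object through which `Q` is cofinal among `κ`-presentable objects is a `κ`-directed
colimit of `κ`-presentable objects satisfying `Q`. -/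
lemma exists_colimitPresentation [IsCardinalAccessibleCategory C κ] {X : C}
    (hX : Q.FactorsThrough κ X) :
    ∃ (α : Type v) (_ : PartialOrder α) (_ : IsCardinalFiltered α κ)
      (p : ColimitPresentation α X),
      ∀ a, Q (p.diag.obj a) ∧ IsCardinalPresentable (p.diag.obj a) κ := by
  let P : ObjectProperty C := Q ⊓ isCardinalPresentable C κ
  let incl : P.FullSubcategory ⥤ (isCardinalPresentable C κ).FullSubcategory :=
    ObjectProperty.ιOfLE inf_le_right
  let G : CostructuredArrow P.ι X ⥤ CostructuredArrow (isCardinalPresentable C κ).ι X :=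
    CostructuredArrow.pre incl (isCardinalPresentable C κ).ι X
  have hG (d : CostructuredArrow (isCardinalPresentable C κ).ι X) :
      ∃ c, Nonempty (d ⟶ G.obj c) := by
    obtain ⟨B, hB, hB', u, v, huv⟩ := hX d.left.property d.hom
    exact ⟨CostructuredArrow.mk (S := P.ι) (Y := FullSubcategory.mk _ ⟨hB, hB'⟩) v,
      ⟨CostructuredArrow.homMk ⟨u⟩ huv⟩⟩
  have : G.Full := inferInstanceAs (CostructuredArrow.pre incl _ X).Full
  have : G.Faithful := inferInstanceAs (CostructuredArrow.pre incl _ X).Faithful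
  have := isFiltered_of_isCardinalFiltered
    (CostructuredArrow (isCardinalPresentable C κ).ι X) κ
  have hfin : G.Final := Functor.final_of_exists_of_isFiltered_of_fullyFaithful G hG
  have : IsCardinalFiltered (CostructuredArrow P.ι X) κ :=
    ⟨fun {A} _ F hA ↦ by
      let c := IsCardinalFiltered.cocone (F ⋙ G) hA
      obtain ⟨x, ⟨f⟩⟩ := hG c.pt
      exact ⟨{ pt := x
               ι := { app := fun a ↦ G.preimage (c.ι.app a ≫ f)
                      naturality := fun a b g ↦ G.map_injective (by
                        have := c.w g
                        simp at this
                        simp [reassoc_of% this]) } }⟩⟩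
  obtain ⟨hc⟩ : P.ι.isDenseAt X :=
    have : (CostructuredArrow.pre incl (isCardinalPresentable C κ).ι X).Final := hfin
    Functor.IsDenseAt.of_final (F := (isCardinalPresentable C κ).ι) incl
      (Functor.IsDense.isDenseAt _ _)
  have : EssentiallySmall.{v} (CostructuredArrow P.ι X) := essentiallySmall_of_fully_faithful G
  have : IsCardinalFiltered (SmallModel.{v} (CostructuredArrow P.ι X)) κ :=
    .of_equivalence κ (equivSmallModel _)
  obtain ⟨α, _, _, F, _⟩ := IsCardinalFiltered.exists_cardinal_directed
    (SmallModel.{v} (CostructuredArrow P.ι X)) κ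
  let p : ColimitPresentation (CostructuredArrow P.ι X) X := ⟨_, _, hc⟩
  exact ⟨α, inferInstance, inferInstance,
    p.reindex (F ⋙ (equivSmallModel _).inverse),
    fun a ↦ (((equivSmallModel (CostructuredArrow P.ι X)).inverse.obj (F.obj a)).left).property⟩

end ObjectProperty.FactorsThrough

end FactorsThrough

end CategoryTheory

namespace CategoryTheory

section Arrow

variable {C : Type u} [Category.{v} C] (κ : Cardinal.{v}) [Fact κ.IsRegular]

lemma Arrow.cocone_w_left {J : Type w} [Category J] {F : J ⥤ Arrow C} (c : Cocone F) {i j : J}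
    (u : i ⟶ j) : (F.map u).left ≫ (c.ι.app j).left = (c.ι.app i).left :=
  congr_arg CommaMorphism.left (c.w u)

lemma Arrow.cocone_w_right {J : Type w} [Category J] {F : J ⥤ Arrow C} (c : Cocone F) {i j : J}
    (u : i ⟶ j) : (F.map u).right ≫ (c.ι.app j).right = (c.ι.app i).right :=
  congr_arg CommaMorphism.right (c.w u)

lemma Arrow.isCardinalPresentable_of_left_right [HasColimits C] (a : Arrow C)
    [IsCardinalPresentable a.left κ] [IsCardinalPresentable a.right κ] :
    IsCardinalPresentable a κ where
  preservesColimitOfShape J _ _ := ⟨fun {F} ↦ ⟨fun {c} hc ↦ by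
    have := isFiltered_of_isCardinalFiltered J κ
    have hl := isColimitOfPreserves Arrow.leftFunc hc
    have hr := isColimitOfPreserves Arrow.rightFunc hc
    refine ⟨Types.FilteredColimit.isColimitOf' _ _ (fun (x : a ⟶ c.pt) ↦ ?_)
      (fun j (x y : a ⟶ F.obj j) hxy ↦ ?_)⟩
    · obtain ⟨j₁, y₁, h₁⟩ : ∃ j, ∃ y : a.left ⟶ (F.obj j).left, y ≫ (c.ι.app j).left = x.left :=
        IsCardinalPresentable.exists_hom_of_isColimit κ hl x.left
      obtain ⟨j₂, y₂, h₂⟩ : ∃ j, ∃ y : a.right ⟶ (F.obj j).right,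
          y ≫ (c.ι.app j).right = x.right :=
        IsCardinalPresentable.exists_hom_of_isColimit κ hr x.right
      let m := IsFiltered.max j₁ j₂
      let z₁ : a.left ⟶ (F.obj m).left := y₁ ≫ (F.map (IsFiltered.leftToMax j₁ j₂)).left
      let z₂ : a.right ⟶ (F.obj m).right := y₂ ≫ (F.map (IsFiltered.rightToMax j₁ j₂)).right
      have hz₁ : z₁ ≫ (c.ι.app m).left = x.left := by
        simp only [z₁, m, Category.assoc, Arrow.cocone_w_left, h₁]
      have hz₂ : z₂ ≫ (c.ι.app m).right = x.right := by
        simp only [z₂, m, Category.assoc, Arrow.cocone_w_right, h₂]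
      clear_value z₁ z₂
      obtain ⟨k, u, hu⟩ : ∃ k, ∃ u : m ⟶ k, (z₁ ≫ (F.obj m).hom) ≫ (F.map u).right =
          (a.hom ≫ z₂) ≫ (F.map u).right :=
        IsCardinalPresentable.exists_eq_of_isColimit' κ hr (z₁ ≫ (F.obj m).hom) (a.hom ≫ z₂) (by
          change (z₁ ≫ (F.obj m).hom) ≫ (c.ι.app m).right = (a.hom ≫ z₂) ≫ (c.ι.app m).right
          rw [Category.assoc, Category.assoc, hz₂, ← Arrow.w x, ← hz₁, Category.assoc]
          exact z₁ ≫= (Arrow.w (c.ι.app m)).symm)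
      refine ⟨k, Arrow.homMk (z₁ ≫ (F.map u).left) (z₂ ≫ (F.map u).right) ?_, ?_⟩
      · simpa using hu
      · change x = Arrow.homMk _ _ _ ≫ c.ι.app k
        ext
        · simp [← hz₁, Arrow.cocone_w_left]
        · simp [← hz₂, Arrow.cocone_w_right]
    · replace hxy : x ≫ c.ι.app j = y ≫ c.ι.app j := hxy
      obtain ⟨k₁, u₁, h₁⟩ : ∃ k, ∃ u : j ⟶ k, x.left ≫ (F.map u).left = y.left ≫ (F.map u).left :=
        IsCardinalPresentable.exists_eq_of_isColimit' κ hl x.left y.left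
          (congr_arg CommaMorphism.left hxy)
      obtain ⟨k₂, u₂, h₂⟩ : ∃ k, ∃ u : j ⟶ k,
          x.right ≫ (F.map u).right = y.right ≫ (F.map u).right :=
        IsCardinalPresentable.exists_eq_of_isColimit' κ hr x.right y.right
          (congr_arg CommaMorphism.right hxy)
      obtain ⟨k, v₁, v₂, hv⟩ := IsFiltered.span u₁ u₂
      refine ⟨k, u₁ ≫ v₁, ?_⟩
      change x ≫ F.map (u₁ ≫ v₁) = y ≫ F.map (u₁ ≫ v₁)
      ext
      · simp [reassoc_of% h₁]
      · simp [hv, reassoc_of% h₂]⟩⟩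

/-- The arrows `⊥_ C ⟶ G` and `𝟙 G` for `G` satisfying `P`. -/
def ObjectProperty.arrowGenerator [HasInitial C] (P : ObjectProperty C) :
    ObjectProperty (Arrow C) :=
  ofObj (Sum.elim (fun G : Subtype P ↦ Arrow.mk (initial.to G.1))
    fun G : Subtype P ↦ Arrow.mk (𝟙 G.1))

instance ObjectProperty.small_arrowGenerator [HasInitial C] (P : ObjectProperty C)
    [ObjectProperty.Small.{v} P] : ObjectProperty.Small.{v} P.arrowGenerator := by
  have : _root_.Small.{v} (Subtype P) := inferInstance
  unfold ObjectProperty.arrowGenerator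
  infer_instance

lemma ObjectProperty.IsStrongGenerator.arrowGenerator [HasInitial C] {P : ObjectProperty C}
    (hP : P.IsStrongGenerator) : P.arrowGenerator.IsStrongGenerator := by
  rw [isStrongGenerator_iff] at hP ⊢
  obtain ⟨hP₁, hP₂⟩ := hP
  have h₀ {G : C} (hG : P G) : P.arrowGenerator (Arrow.mk (initial.to G)) :=
    ofObj_apply (Sum.elim (fun G : Subtype P ↦ Arrow.mk (initial.to G.1))
      fun G : Subtype P ↦ Arrow.mk (𝟙 G.1)) (.inl ⟨G, hG⟩)
  have h₁ {G : C} (hG : P G) : P.arrowGenerator (Arrow.mk (𝟙 G)) :=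
    ofObj_apply (Sum.elim (fun G : Subtype P ↦ Arrow.mk (initial.to G.1))
      fun G : Subtype P ↦ Arrow.mk (𝟙 G.1)) (.inr ⟨G, hG⟩)
  let r {G : C} {X : Arrow C} (f : G ⟶ X.right) : Arrow.mk (initial.to G) ⟶ X :=
    Arrow.homMk (initial.to _) f (Subsingleton.elim (α := ⊥_ C ⟶ _) _ _)
  let l {G : C} {X : Arrow C} (f : G ⟶ X.left) : Arrow.mk (𝟙 G) ⟶ X :=
    Arrow.homMk f (f ≫ X.hom) (by simp)
  refine ⟨fun X Y f g hfg ↦ ?_, fun X Y i _ hi ↦ ?_⟩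
  · ext
    · exact hP₁ _ _ fun G hG h ↦ congr_arg CommaMorphism.left (hfg _ (h₁ hG) (l h))
    · exact hP₁ _ _ fun G hG h ↦ congr_arg CommaMorphism.right (hfg _ (h₀ hG) (r h))
  · have : Mono i.left := ⟨fun f g hfg ↦ by
      have : l f ≫ i = l g ≫ i := by
        ext
        · exact hfg
        · change (f ≫ X.hom) ≫ i.right = (g ≫ X.hom) ≫ i.right
          rw [Category.assoc, Category.assoc, ← Arrow.w i, reassoc_of% hfg]
      exact congr_arg CommaMorphism.left ((cancel_mono i).1 this)⟩
    have : Mono i.right := ⟨fun f g hfg ↦ by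
      have : r f ≫ i = r g ≫ i := by
        ext
        · exact Subsingleton.elim (α := ⊥_ C ⟶ _) _ _
        · exact hfg
      exact congr_arg CommaMorphism.right ((cancel_mono i).1 this)⟩
    have : IsIso i.left := hP₂ _ fun G hG f ↦ by
      obtain ⟨g, hg⟩ := hi _ (h₁ hG) (l f)
      exact ⟨g.left, congr_arg CommaMorphism.left hg⟩
    have : IsIso i.right := hP₂ _ fun G hG f ↦ by
      obtain ⟨g, hg⟩ := hi _ (h₀ hG) (r f)
      exact ⟨g.right, congr_arg CommaMorphism.right hg⟩
    exact Arrow.isIso_of_isIso_left_of_isIso_right i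

lemma isCardinalPresentable_initial [HasInitial C] : IsCardinalPresentable (⊥_ C) κ :=
  have (j : Discrete PEmpty.{1}) :
    IsCardinalPresentable ((Functor.empty.{0} C).obj j) κ := j.as.elim
  isCardinalPresentable_of_isColimit _ (colimit.isColimit (Functor.empty.{0} C)) κ
    (hasCardinalLT_of_finite _ _ (Cardinal.IsRegular.aleph0_le Fact.out))

lemma ObjectProperty.arrowGenerator_le [HasColimits C] {P : ObjectProperty C}
    (hP : P ≤ isCardinalPresentable C κ) :
    P.arrowGenerator ≤ isCardinalPresentable (Arrow C) κ := by
  have := isCardinalPresentable_initial (C := C) κ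
  rintro _ ⟨⟨G, hG⟩ | ⟨G, hG⟩⟩
  all_goals
    have : IsCardinalPresentable G κ := hP _ hG
  · have : IsCardinalPresentable (Arrow.mk (initial.to G)).left κ :=
      ‹IsCardinalPresentable (⊥_ C) κ›
    have : IsCardinalPresentable (Arrow.mk (initial.to G)).right κ := ‹IsCardinalPresentable G κ›
    exact Arrow.isCardinalPresentable_of_left_right κ (Arrow.mk (initial.to G))
  · have : IsCardinalPresentable (Arrow.mk (𝟙 G)).left κ := ‹IsCardinalPresentable G κ›
    have : IsCardinalPresentable (Arrow.mk (𝟙 G)).right κ := ‹IsCardinalPresentable G κ›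
    exact Arrow.isCardinalPresentable_of_left_right κ (Arrow.mk (𝟙 G))

variable [IsCardinalLocallyPresentable C κ]

instance Arrow.isCardinalLocallyPresentable : IsCardinalLocallyPresentable (Arrow C) κ := by
  obtain ⟨P, _, hP₁, hP₂⟩ :=
    (IsCardinalLocallyPresentable.iff_exists_isStrongGenerator C κ).1 inferInstance
  have : HasColimits C := inferInstanceAs (HasColimitsOfSize.{v, v} C)
  rw [IsCardinalLocallyPresentable.iff_exists_isStrongGenerator]
  exact ⟨_, inferInstance, hP₁.arrowGenerator, ObjectProperty.arrowGenerator_le κ hP₂⟩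

lemma Arrow.isCardinalPresentable_left_and_right (a : Arrow C) [IsCardinalPresentable a κ] :
    IsCardinalPresentable a.left κ ∧ IsCardinalPresentable a.right κ := by
  obtain ⟨P, _, hP₁, hP₂⟩ :=
    (IsCardinalLocallyPresentable.iff_exists_isStrongGenerator C κ).1 inferInstance
  have : HasColimits C := inferInstanceAs (HasColimitsOfSize.{v, v} C)
  let Q : ObjectProperty (Arrow C) :=
    (isCardinalPresentable C κ).inverseImage Arrow.leftFunc ⊓
      (isCardinalPresentable C κ).inverseImage Arrow.rightFunc
  have hQ : P.arrowGenerator.colimitsCardinalClosure κ ≤ Q := by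
    refine ObjectProperty.colimitsCardinalClosure_le _ _ (fun J _ hJ ↦ ⟨?_⟩) ?_
    · rintro X ⟨p⟩
      have := isClosedUnderColimitsOfShape_isCardinalPresentable C hJ
      exact ⟨ObjectProperty.prop_of_isColimit _ (isColimitOfPreserves Arrow.leftFunc p.isColimit)
          fun j ↦ (p.prop_diag_obj j).1,
        ObjectProperty.prop_of_isColimit _ (isColimitOfPreserves Arrow.rightFunc p.isColimit)
          fun j ↦ (p.prop_diag_obj j).2⟩
    · rintro _ ⟨⟨G, hG⟩ | ⟨G, hG⟩⟩
      · exact ⟨isCardinalPresentable_initial κ, hP₂ _ hG⟩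
      · exact ⟨hP₂ _ hG, hP₂ _ hG⟩
  refine hQ a ?_
  rw [← IsStrongGenerator.colimitsCardinalClosure_eq_isCardinalPresentable hP₁.arrowGenerator
    (ObjectProperty.arrowGenerator_le κ hP₂)]
  assumption

end Arrow

end CategoryTheory

namespace CategoryTheory

lemma hasCardinalLT_arrow_nat {κ : Cardinal.{v}} (hκ : Cardinal.aleph0 < κ) :
    HasCardinalLT (Arrow ℕ) κ := by
  have h : Function.Injective (fun a : Arrow ℕ ↦ (a.left, a.right)) := fun a b h ↦ by
    simp only [Prod.mk.injEq] at h
    exact Arrow.ext h.1 h.2 (Subsingleton.elim _ _)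
  have : Countable (Arrow ℕ) := h.countable
  refine lt_of_le_of_lt (b := Cardinal.aleph0) ?_ ?_
  · simp
  · simpa using hκ

namespace MorphismProperty

variable {C : Type u} [Category.{v} C] {κ : Cardinal.{v}} [Fact κ.IsRegular]

lemma rlp_of_isColimit {I : MorphismProperty C}
    (hI : ∀ ⦃A B : C⦄ (i : A ⟶ B), I i → IsCardinalPresentable A κ ∧ IsCardinalPresentable B κ)
    {J : Type v} [SmallCategory J] [IsCardinalFiltered J κ] {G H : J ⥤ C} (τ : G ⟶ H)
    {cG : Cocone G} (hG : IsColimit cG) {cH : Cocone H} (hH : IsColimit cH)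
    (q : cG.pt ⟶ cH.pt) (hq : ∀ j, cG.ι.app j ≫ q = τ.app j ≫ cH.ι.app j)
    (hτ : ∀ j, I.rlp (τ.app j)) : I.rlp q := fun A B i hi ↦ ⟨fun {f g} sq ↦ by
  obtain ⟨hA, hB⟩ := hI i hi
  have := isFiltered_of_isCardinalFiltered J κ
  obtain ⟨j₁, f', hf'⟩ := IsCardinalPresentable.exists_hom_of_isColimit κ hG f
  obtain ⟨j₂, g', hg'⟩ := IsCardinalPresentable.exists_hom_of_isColimit κ hH g
  let m := IsFiltered.max j₁ j₂
  let f₁ : A ⟶ G.obj m := f' ≫ G.map (IsFiltered.leftToMax j₁ j₂)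
  let g₁ : B ⟶ H.obj m := g' ≫ H.map (IsFiltered.rightToMax j₁ j₂)
  have hf₁ : f₁ ≫ cG.ι.app m = f := by simp [f₁, m, hf']
  have hg₁ : g₁ ≫ cH.ι.app m = g := by simp [g₁, m, hg']
  clear_value f₁ g₁ m
  obtain ⟨k, u, hu⟩ := IsCardinalPresentable.exists_eq_of_isColimit' κ hH
    (f₁ ≫ τ.app m) (i ≫ g₁) (by
      rw [Category.assoc, ← hq, reassoc_of% hf₁, Category.assoc, hg₁, sq.w])
  have := hτ k i hi
  have sq' : CommSq (f₁ ≫ G.map u) i (τ.app k) (g₁ ≫ H.map u) := ⟨by simpa using hu⟩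
  exact ⟨⟨{ l := sq'.lift ≫ cG.ι.app k
            fac_left := by simp [hf₁]
            fac_right := by simp [hq, hg₁] }⟩⟩⟩

namespace FunctorialFactorizationData

variable {W₁ W₂ : MorphismProperty C} (data : FunctorialFactorizationData W₁ W₂)

/-- The first morphism of the factorization of `a`. -/
def fst (a : Arrow C) : a.left ⟶ data.Z.obj a := data.i.app a

/-- The second morphism of the factorization of `a`. -/
def snd (a : Arrow C) : data.Z.obj a ⟶ a.right := data.p.app a

lemma fst_naturality {a b : Arrow C} (φ : a ⟶ b) :
    φ.left ≫ data.fst b = data.fst a ≫ data.Z.map φ := data.i.naturality φ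

lemma snd_naturality {a b : Arrow C} (φ : a ⟶ b) :
    data.Z.map φ ≫ data.snd b = data.snd a ≫ φ.right := data.p.naturality φ

lemma fst_snd (a : Arrow C) : data.fst a ≫ data.snd a = a.hom := data.fac_app

variable {J : Type v} [SmallCategory J] {F : J ⥤ Arrow C} {c : Cocone F}
  {cE : Cocone (F ⋙ data.Z)} (s : c.pt.right ⟶ cE.pt)

/-- A morphism `t` approximating, at the stage `j`, a section `s` of the second morphism of the
factorization. -/
structure ApproxSection (j : J) where
  k : J
  u : j ⟶ k
  t : (F.obj j).right ⟶ data.Z.obj (F.obj k)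
  t_ι : t ≫ cE.ι.app k = (c.ι.app j).right ≫ s
  t_snd : t ≫ data.snd (F.obj k) = (F.map u).right
  hom_t : (F.obj j).hom ≫ t = (F.map u).left ≫ data.fst (F.obj k)

namespace ApproxSection

variable {data s}

/-- Postcompose an approximate section with a transition morphism. -/
def postcomp {j : J} (x : ApproxSection data s j) {k : J} (v : x.k ⟶ k) :
    ApproxSection data s j where
  k := k
  u := x.u ≫ v
  t := x.t ≫ data.Z.map (F.map v)
  t_ι := by
    rw [← x.t_ι, Category.assoc]
    exact x.t ≫= cE.w v
  t_snd := by
    rw [Category.assoc, snd_naturality, reassoc_of% x.t_snd, F.map_comp, Arrow.comp_right]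
  hom_t := by
    rw [reassoc_of% x.hom_t, F.map_comp, Arrow.comp_left, Category.assoc, fst_naturality]

variable [IsCardinalFiltered J κ] (hc : IsColimit (Arrow.rightFunc.mapCocone c))
  (hE : IsColimit cE) {q : cE.pt ⟶ c.pt.right} (hsq : s ≫ q = 𝟙 _)
  (hq : ∀ j, cE.ι.app j ≫ q = data.snd (F.obj j) ≫ (c.ι.app j).right)
  (hs : ∀ j, (c.ι.app j).left ≫ c.pt.hom ≫ s = data.fst (F.obj j) ≫ cE.ι.app j)
  [∀ j, IsCardinalPresentable (F.obj j).left κ] [∀ j, IsCardinalPresentable (F.obj j).right κ]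

include κ hc hE hsq hq hs in
lemma nonempty (j : J) : Nonempty (ApproxSection data s j) := by
  have := isFiltered_of_isCardinalFiltered J κ
  obtain ⟨k₀, t₀, h₀⟩ : ∃ k, ∃ t : (F.obj j).right ⟶ data.Z.obj (F.obj k),
      t ≫ cE.ι.app k = (c.ι.app j).right ≫ s :=
    IsCardinalPresentable.exists_hom_of_isColimit κ hE _
  let m := IsFiltered.max k₀ j
  let a : j ⟶ m := IsFiltered.rightToMax k₀ j
  let t₁ : (F.obj j).right ⟶ data.Z.obj (F.obj m) :=
    t₀ ≫ data.Z.map (F.map (IsFiltered.leftToMax k₀ j))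
  have h₁ : t₁ ≫ cE.ι.app m = (c.ι.app j).right ≫ s := by
    rw [← h₀, Category.assoc]
    exact t₀ ≫= cE.w (IsFiltered.leftToMax k₀ j)
  clear_value t₁ a m
  obtain ⟨k₁, v₁, hv₁⟩ : ∃ k, ∃ v : m ⟶ k,
      (t₁ ≫ data.snd (F.obj m)) ≫ (F.map v).right = (F.map a).right ≫ (F.map v).right :=
    IsCardinalPresentable.exists_eq_of_isColimit' κ hc (t₁ ≫ data.snd (F.obj m))
      (F.map a).right (by
        change (t₁ ≫ data.snd (F.obj m)) ≫ (c.ι.app m).right =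
          (F.map a).right ≫ (c.ι.app m).right
        rw [Category.assoc, ← hq, reassoc_of% h₁, hsq, Arrow.cocone_w_right]
        exact Category.comp_id (Y := c.pt.right) _)
  obtain ⟨k₂, v₂, hv₂⟩ : ∃ k, ∃ v : m ⟶ k,
      ((F.obj j).hom ≫ t₁) ≫ data.Z.map (F.map v) =
        ((F.map a).left ≫ data.fst (F.obj m)) ≫ data.Z.map (F.map v) :=
    IsCardinalPresentable.exists_eq_of_isColimit' κ hE ((F.obj j).hom ≫ t₁)
      ((F.map a).left ≫ data.fst (F.obj m)) (by
        rw [Category.assoc, h₁, Category.assoc, ← hs]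
        have h : (F.map a).left ≫ (c.ι.app m).left ≫ c.pt.hom =
            (F.obj j).hom ≫ (c.ι.app j).right := by
          rw [← Category.assoc, Arrow.cocone_w_left]
          exact CategoryTheory.Arrow.w (g := c.pt) (c.ι.app j)
        simpa using (h =≫ s).symm)
  obtain ⟨k, w₁, w₂, hw⟩ := IsFiltered.span v₁ v₂
  exact ⟨{
    k := k
    u := a ≫ v₁ ≫ w₁
    t := t₁ ≫ data.Z.map (F.map (v₁ ≫ w₁))
    t_ι := by
      rw [← h₁, Category.assoc]
      exact t₁ ≫= cE.w (v₁ ≫ w₁)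
    t_snd := by
      rw [Category.assoc] at hv₁
      rw [Category.assoc, snd_naturality]
      simp [reassoc_of% hv₁]
    hom_t := by
      rw [hw]
      simp only [Category.assoc] at hv₂
      rw [F.map_comp a, Arrow.comp_left, Category.assoc, fst_naturality]
      simp [reassoc_of% hv₂] }⟩

include κ hc hE hsq hq hs in
lemma exists_next {j : J} (x : ApproxSection data s j) :
    ∃ y : ApproxSection data s x.k,
      x.t ≫ data.Z.map (F.map y.u) = (F.map x.u).right ≫ y.t := by
  obtain ⟨y⟩ := nonempty (κ := κ) hc hE hsq hq hs x.k
  obtain ⟨k, v, hv⟩ : ∃ k, ∃ v : y.k ⟶ k,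
      (x.t ≫ data.Z.map (F.map y.u)) ≫ data.Z.map (F.map v) =
        ((F.map x.u).right ≫ y.t) ≫ data.Z.map (F.map v) :=
    IsCardinalPresentable.exists_eq_of_isColimit' κ hE (x.t ≫ data.Z.map (F.map y.u))
      ((F.map x.u).right ≫ y.t) (by
        rw [Category.assoc, Category.assoc, y.t_ι]
        refine (x.t ≫= cE.w y.u).trans (x.t_ι.trans ?_)
        rw [← Arrow.cocone_w_right c x.u, Category.assoc])
  exact ⟨y.postcomp v, by simpa [postcomp] using hv⟩

end ApproxSection

end FunctorialFactorizationData

end MorphismProperty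

end CategoryTheory

namespace CategoryTheory

namespace MorphismProperty

variable {C : Type u} [Category.{v} C] {κ : Cardinal.{v}} [Fact κ.IsRegular]

/-- The property of being an arrow in `W`, as a property of objects of the arrow category. -/
def arrowProp (W : MorphismProperty C) : ObjectProperty (Arrow C) := fun a ↦ W a.hom

namespace FunctorialFactorizationData

variable {W₁ W₂ : MorphismProperty C} (data : FunctorialFactorizationData W₁ W₂)

/-- If the second morphism of the functorial factorization of `a` has a section under `a.left`,
then `a` is a retract of the first morphism. -/
lemma prop_of_section [W₁.IsStableUnderRetracts] {a : Arrow C} (σ : a.right ⟶ data.Z.obj a)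
    (h₁ : a.hom ≫ σ = data.fst a) (h₂ : σ ≫ data.snd a = 𝟙 _) : W₁ a.hom :=
  W₁.of_retract (g := data.fst a)
    { i := CategoryTheory.Arrow.homMk (𝟙 a.left) σ (by simpa using h₁.symm)
      r := CategoryTheory.Arrow.homMk (𝟙 a.left) (data.snd a)
        (by simpa using (data.fst_snd a).symm)
      retract := by ext <;> simp [h₂] } (data.hi a)

variable {data} [HasColimits C] {J : Type v} [SmallCategory J] {F : J ⥤ Arrow C} {c : Cocone F}
  {cE : Cocone (F ⋙ data.Z)} {s : c.pt.right ⟶ cE.pt}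

/-- An `ω`-chain of compatible approximate sections produces an object satisfying `W₁`. -/
lemma ApproxSection.exists_of_sequence [W₁.IsStableUnderRetracts] (hκ : Cardinal.aleph0 < κ)
    [∀ j, IsCardinalPresentable (F.obj j) κ]
    (hnext : ∀ ⦃j : J⦄ (x : ApproxSection data s j), ∃ y : ApproxSection data s x.k,
      x.t ≫ data.Z.map (F.map y.u) = (F.map x.u).right ≫ y.t)
    {j₀ : J} (x₀ : ApproxSection data s j₀) :
    ∃ (b : Arrow C) (_ : W₁ b.hom) (_ : IsCardinalPresentable b κ) (α : F.obj j₀ ⟶ b)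
      (β : b ⟶ c.pt), α ≫ β = c.ι.app j₀ := by
  choose next hnext using hnext
  let seq : ℕ → Σ j, ApproxSection data s j :=
    fun n ↦ Nat.rec ⟨j₀, x₀⟩ (fun _ x ↦ ⟨x.2.k, next x.2⟩) n
  let G : ℕ ⥤ J := Functor.ofSequence (X := fun n ↦ (seq n).1) (fun n ↦ (seq n).2.u)
  have hG (n : ℕ) : G.map (homOfLE (Nat.le_add_right n 1)) = (seq n).2.u :=
    Functor.ofSequence_map_homOfLE_succ _ n
  let t (n : ℕ) : (F.obj (G.obj n)).right ⟶ data.Z.obj (F.obj (G.obj (n + 1))) := (seq n).2.t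
  have t_snd (n : ℕ) : t n ≫ data.snd _ =
      (F.map (G.map (homOfLE (Nat.le_add_right n 1)))).right := by
    rw [hG]; exact (seq n).2.t_snd
  have hom_t (n : ℕ) : (F.obj (G.obj n)).hom ≫ t n =
      (F.map (G.map (homOfLE (Nat.le_add_right n 1)))).left ≫ data.fst _ := by
    rw [hG]; exact (seq n).2.hom_t
  have ht (n : ℕ) : t n ≫ data.Z.map (F.map (G.map (homOfLE (Nat.le_add_right (n + 1) 1)))) =
      (F.map (G.map (homOfLE (Nat.le_add_right n 1)))).right ≫ t (n + 1) := by
    rw [hG, hG]; exact hnext (seq n).2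
  have hG₀ : G.obj 0 = j₀ := rfl
  clear_value t
  have : HasColimitsOfSize.{0, 0} C := hasColimitsOfSizeShrink.{0, 0, v, v} C
  let D : ℕ ⥤ Arrow C := G ⋙ F
  let d : Cocone D := colimit.cocone D
  have hd : IsColimit d := colimit.isColimit D
  have hl : IsColimit (Arrow.leftFunc.mapCocone d) := isColimitOfPreserves _ hd
  have hr : IsColimit (Arrow.rightFunc.mapCocone d) := isColimitOfPreserves _ hd
  have (n : ℕ) : IsCardinalPresentable (D.obj n) κ :=
    inferInstanceAs (IsCardinalPresentable (F.obj (G.obj n)) κ)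
  clear_value d
  have hZ (n : ℕ) : data.Z.map (F.map (G.map (homOfLE (Nat.le_add_right n 1)))) ≫
      data.Z.map (d.ι.app (n + 1)) = data.Z.map (d.ι.app n) := by
    rw [← data.Z.map_comp]
    exact congr_arg data.Z.map (d.w (homOfLE (Nat.le_add_right n 1)))
  let τ : D ⋙ Arrow.rightFunc ⟶ (Functor.const ℕ).obj (data.Z.obj d.pt) :=
    NatTrans.ofSequence (fun n ↦ t n ≫ data.Z.map (d.ι.app (n + 1))) (fun n ↦ by
      change (F.map (G.map (homOfLE (Nat.le_add_right n 1)))).right ≫ t (n + 1) ≫ _ = _ ≫ 𝟙 _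
      rw [← reassoc_of% (ht n), hZ]
      exact (Category.comp_id (Y := data.Z.obj d.pt) _).symm)
  let σ : d.pt.right ⟶ data.Z.obj d.pt := hr.desc ⟨_, τ⟩
  have hσ (n : ℕ) : (d.ι.app n).right ≫ σ = t n ≫ data.Z.map (d.ι.app (n + 1)) :=
    hr.fac ⟨_, τ⟩ n
  clear_value σ
  have hb : IsCardinalPresentable d.pt κ :=
    isCardinalPresentable_of_isColimit d hd κ (hasCardinalLT_arrow_nat hκ)
  refine ⟨d.pt, data.prop_of_section σ ?_ ?_, hb, d.ι.app 0, hd.desc (c.whisker G),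
    hd.fac (c.whisker G) 0⟩
  · refine hl.hom_ext fun n ↦ ?_
    change (d.ι.app n).left ≫ d.pt.hom ≫ σ = (d.ι.app n).left ≫ data.fst d.pt
    have h₁ : (d.ι.app n).left ≫ d.pt.hom = (F.obj (G.obj n)).hom ≫ (d.ι.app n).right :=
      CategoryTheory.Arrow.w (g := d.pt) (d.ι.app n)
    have h₂ (n : ℕ) : (d.ι.app n).left ≫ data.fst d.pt =
      data.fst (F.obj (G.obj n)) ≫ data.Z.map (d.ι.app n) := data.fst_naturality (d.ι.app n)
    have h₃ := CategoryTheory.Arrow.cocone_w_left d (homOfLE (Nat.le_add_right n 1))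
    calc _ = ((d.ι.app n).left ≫ d.pt.hom) ≫ σ := (Category.assoc _ _ _).symm
      _ = (F.obj (G.obj n)).hom ≫ t n ≫ data.Z.map (d.ι.app (n + 1)) := by
        rw [h₁, Category.assoc, hσ]
      _ = (F.map (G.map (homOfLE (Nat.le_add_right n 1)))).left ≫
          (d.ι.app (n + 1)).left ≫ data.fst d.pt := by rw [reassoc_of% (hom_t n), h₂]
      _ = _ := by
        rw [← h₃]
        exact (Category.assoc _ _ _).symm
  · refine hr.hom_ext fun n ↦ ?_
    change (d.ι.app n).right ≫ σ ≫ data.snd d.pt = (d.ι.app n).right ≫ 𝟙 d.pt.right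
    have h₂ (n : ℕ) : data.Z.map (d.ι.app n) ≫ data.snd d.pt =
      data.snd (F.obj (G.obj n)) ≫ (d.ι.app n).right := data.snd_naturality (d.ι.app n)
    have h₃ := CategoryTheory.Arrow.cocone_w_right d (homOfLE (Nat.le_add_right n 1))
    rw [Category.comp_id (Y := d.pt.right)]
    refine Eq.trans ?_ h₃
    rw [reassoc_of% (hσ n), h₂, reassoc_of% (t_snd n)]
    rfl

end FunctorialFactorizationData

/-- For an uncountable `κ`, morphisms in the left class of a functorial weak factorization
system generated by `I` are approximated by `κ`-presentable ones. -/
lemma factorsThrough_llp_rlp_of_aleph0_lt [IsCardinalLocallyPresentable C κ]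
    (hκ : Cardinal.aleph0 < κ) {I : MorphismProperty C}
    (hI : ∀ ⦃A B : C⦄ (i : A ⟶ B), I i → IsCardinalPresentable A κ ∧ IsCardinalPresentable B κ)
    (data : FunctorialFactorizationData I.rlp.llp I.rlp) {f : Arrow C} (hf : I.rlp.llp f.hom) :
    I.rlp.llp.arrowProp.FactorsThrough κ f := by
  have : HasColimits C := inferInstanceAs (HasColimitsOfSize.{v, v} C)
  intro A hA φ
  obtain ⟨J, _, _, ⟨pres⟩⟩ := (isCardinalFilteredGenerator_isCardinalPresentable
    (Arrow C) κ).exists_colimitsOfShape f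
  let F : J ⥤ Arrow C := pres.diag
  let c : Cocone F := pres.cocone
  have hc : IsColimit c := pres.isColimit
  have hF (j : J) : IsCardinalPresentable (F.obj j) κ := pres.prop_diag_obj j
  have hFl (j : J) : IsCardinalPresentable (F.obj j).left κ :=
    (CategoryTheory.Arrow.isCardinalPresentable_left_and_right κ (F.obj j)).1
  have hFr (j : J) : IsCardinalPresentable (F.obj j).right κ :=
    (CategoryTheory.Arrow.isCardinalPresentable_left_and_right κ (F.obj j)).2
  replace hf : I.rlp.llp c.pt.hom := hf
  obtain ⟨j₀, ψ, hψ⟩ : ∃ j, ∃ ψ : A ⟶ F.obj j, ψ ≫ c.ι.app j = φ :=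
    IsCardinalPresentable.exists_hom_of_isColimit κ hc φ
  suffices ∃ (b : Arrow C) (_ : I.rlp.llp b.hom) (_ : IsCardinalPresentable b κ)
      (α : F.obj j₀ ⟶ b) (β : b ⟶ c.pt), α ≫ β = c.ι.app j₀ by
    obtain ⟨b, hb, hb', α, β, h⟩ := this
    exact ⟨b, hb, hb', ψ ≫ α, β, by rw [← hψ, ← h, Category.assoc]⟩
  clear hψ
  clear_value F c
  have hl := isColimitOfPreserves Arrow.leftFunc hc
  have hr := isColimitOfPreserves Arrow.rightFunc hc
  let cE := colimit.cocone (F ⋙ data.Z)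
  have hE : IsColimit cE := colimit.isColimit _
  clear_value cE
  let g : c.pt.left ⟶ cE.pt := hl.desc ⟨_, F.whiskerLeft data.i ≫ cE.ι⟩
  have hg (j : J) : (c.ι.app j).left ≫ g = data.fst (F.obj j) ≫ cE.ι.app j :=
    hl.fac ⟨_, F.whiskerLeft data.i ≫ cE.ι⟩ j
  let q : cE.pt ⟶ c.pt.right :=
    hE.desc ⟨_, F.whiskerLeft data.p ≫ (Arrow.rightFunc.mapCocone c).ι⟩
  have hq (j : J) : cE.ι.app j ≫ q = data.snd (F.obj j) ≫ (c.ι.app j).right :=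
    hE.fac ⟨_, F.whiskerLeft data.p ≫ (Arrow.rightFunc.mapCocone c).ι⟩ j
  clear_value g q
  have hgq : g ≫ q = c.pt.hom := hl.hom_ext fun j ↦ by
    change (c.ι.app j).left ≫ g ≫ q = (c.ι.app j).left ≫ c.pt.hom
    rw [reassoc_of% (hg j), hq, reassoc_of% (data.fst_snd (F.obj j))]
    exact (CategoryTheory.Arrow.w (g := c.pt) (c.ι.app j)).symm
  have hq' : I.rlp q := rlp_of_isColimit hI (F.whiskerLeft data.p) hE hr q hq
    (fun j ↦ data.hp (F.obj j))
  have := hf q hq'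
  have sq : CommSq g c.pt.hom q (𝟙 _) := ⟨by simp [hgq]⟩
  let s : c.pt.right ⟶ cE.pt := sq.lift
  have hs (j : J) : (c.ι.app j).left ≫ c.pt.hom ≫ s = data.fst (F.obj j) ≫ cE.ι.app j := by
    rw [← hg, sq.fac_left]
  have hsq : s ≫ q = 𝟙 _ := sq.fac_right
  clear_value s
  obtain ⟨x₀⟩ := FunctorialFactorizationData.ApproxSection.nonempty (κ := κ) hr hE hsq hq hs j₀
  exact FunctorialFactorizationData.ApproxSection.exists_of_sequence hκ
    (fun _ x ↦ x.exists_next (κ := κ) hr hE hsq hq hs) x₀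

end MorphismProperty

end CategoryTheory

namespace CategoryTheory

variable {C : Type u} [Category.{v} C] {κ : Cardinal.{v}} [Fact κ.IsRegular]

lemma Arrow.isCardinalPresentable_mk [HasColimits C] {A B : C} (i : A ⟶ B)
    (hA : IsCardinalPresentable A κ) (hB : IsCardinalPresentable B κ) :
    IsCardinalPresentable (Arrow.mk i) κ :=
  have : IsCardinalPresentable (Arrow.mk i).left κ := hA
  have : IsCardinalPresentable (Arrow.mk i).right κ := hB
  Arrow.isCardinalPresentable_of_left_right κ (Arrow.mk i)

lemma isCardinalPresentable_pushout {X Y Z : C} (f : X ⟶ Y) (g : X ⟶ Z) [HasPushout f g]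
    (hX : IsCardinalPresentable X κ) (hY : IsCardinalPresentable Y κ)
    (hZ : IsCardinalPresentable Z κ) : IsCardinalPresentable (pushout f g) κ := by
  have (k : WalkingSpan) : IsCardinalPresentable ((span f g).obj k) κ := by
    obtain _ | _ | _ := k <;> assumption
  exact isCardinalPresentable_of_isColimit _ (colimit.isColimit (span f g)) κ
    (hasCardinalLT_of_finite _ _ (Cardinal.IsRegular.aleph0_le Fact.out))

namespace MorphismProperty

/-- The morphisms `f` such that any morphism to `f` from a `κ`-presentable object of the arrow
category factors through a `κ`-presentable arrow in `W`. -/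
def approximable (W : MorphismProperty C) (κ : Cardinal.{v}) [Fact κ.IsRegular] :
    MorphismProperty C :=
  fun _ _ f ↦ W.arrowProp.FactorsThrough κ (CategoryTheory.Arrow.mk f)

namespace approximable

variable {W : MorphismProperty C} [IsCardinalLocallyPresentable C κ]

lemma exists_factorization {X Y : C} {f : X ⟶ Y} (hf : W.approximable κ f) {A B : C} {i : A ⟶ B}
    (hA : IsCardinalPresentable A κ) (hB : IsCardinalPresentable B κ) {a : A ⟶ X} {b : B ⟶ Y}
    (h : i ≫ b = a ≫ f) :
    ∃ (A' B' : C) (l : A' ⟶ B') (_ : W l) (_ : IsCardinalPresentable A' κ)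
      (_ : IsCardinalPresentable B' κ) (α : A ⟶ A') (β : B ⟶ B') (a' : A' ⟶ X) (b' : B' ⟶ Y),
      i ≫ β = α ≫ l ∧ l ≫ b' = a' ≫ f ∧ α ≫ a' = a ∧ β ≫ b' = b := by
  have : HasColimits C := inferInstanceAs (HasColimitsOfSize.{v, v} C)
  obtain ⟨g, hg, hg', α, β, hαβ⟩ := hf
    (CategoryTheory.Arrow.isCardinalPresentable_mk i hA hB)
    (CategoryTheory.Arrow.homMk (f := CategoryTheory.Arrow.mk i) (g := CategoryTheory.Arrow.mk f)
      a b h.symm)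
  obtain ⟨hl, hr⟩ := CategoryTheory.Arrow.isCardinalPresentable_left_and_right κ g
  exact ⟨g.left, g.right, g.hom, hg, hl, hr, α.left, α.right, β.left, β.right,
    (CategoryTheory.Arrow.w α).symm, (CategoryTheory.Arrow.w β).symm,
    congr_arg CommaMorphism.left hαβ, congr_arg CommaMorphism.right hαβ⟩

lemma of_exists_factorization {X Y : C} {f : X ⟶ Y}
    (hf : ∀ ⦃A B : C⦄ (i : A ⟶ B) (_ : IsCardinalPresentable A κ)
      (_ : IsCardinalPresentable B κ) (a : A ⟶ X) (b : B ⟶ Y), i ≫ b = a ≫ f →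
      ∃ (A' B' : C) (l : A' ⟶ B') (_ : W l) (_ : IsCardinalPresentable A' κ)
        (_ : IsCardinalPresentable B' κ) (α : A ⟶ A') (β : B ⟶ B') (a' : A' ⟶ X) (b' : B' ⟶ Y),
        i ≫ β = α ≫ l ∧ l ≫ b' = a' ≫ f ∧ α ≫ a' = a ∧ β ≫ b' = b) :
    W.approximable κ f := fun g hg φ ↦ by
  have : HasColimits C := inferInstanceAs (HasColimitsOfSize.{v, v} C)
  obtain ⟨hl, hr⟩ := CategoryTheory.Arrow.isCardinalPresentable_left_and_right κ g
  obtain ⟨A', B', l, hW, hA', hB', α, β, a', b', h₁, h₂, h₃, h₄⟩ :=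
    hf g.hom hl hr φ.left φ.right (CategoryTheory.Arrow.w φ).symm
  exact ⟨CategoryTheory.Arrow.mk l, hW,
    CategoryTheory.Arrow.isCardinalPresentable_mk l hA' hB',
    CategoryTheory.Arrow.homMk α β h₁.symm, CategoryTheory.Arrow.homMk a' b' h₂.symm,
    by ext <;> assumption⟩

lemma of_isCardinalPresentable {X Y : C} {f : X ⟶ Y} (hf : W f) (hX : IsCardinalPresentable X κ)
    (hY : IsCardinalPresentable Y κ) : W.approximable κ f :=
  have : HasColimits C := inferInstanceAs (HasColimitsOfSize.{v, v} C)
  .of_prop hf (CategoryTheory.Arrow.isCardinalPresentable_mk f hX hY)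

instance : (W.approximable κ).IsStableUnderRetracts where
  of_retract r hg := ObjectProperty.FactorsThrough.of_retract r hg

instance [W.ContainsIdentities] [W.IsStableUnderComposition] [W.IsStableUnderCobaseChange] :
    (W.approximable κ).IsMultiplicative where
  id_mem X := of_exists_factorization fun A B i _ hB a b h ↦
    ⟨B, B, 𝟙 B, W.id_mem B, hB, hB, i, 𝟙 B, b, b, by simp, by simp, by simpa using h, by simp⟩
  comp_mem f g hf hg := of_exists_factorization fun A B i hA hB a b h ↦ by
    obtain ⟨E, D, l, hl, hE, hD, α, β, a', b', h₁, h₂, h₃, h₄⟩ :=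
      hg.exists_factorization (i := i) (a := a ≫ f) (b := b) hA hB (by simpa using h)
    obtain ⟨C₀, C₁, m, hm, hC₀, hC₁, α₂, β₂, a₂, b₂, k₁, k₂, k₃, k₄⟩ :=
      hf.exists_factorization (i := α) (a := a) (b := a') hA hE h₃
    have : HasColimits C := inferInstanceAs (HasColimitsOfSize.{v, v} C)
    have sq := IsPushout.of_hasPushout β₂ l
    refine ⟨C₀, pushout β₂ l, m ≫ pushout.inl _ _, W.comp_mem _ _ hm (W.of_isPushout sq hl),
      hC₀, ?_, α₂, β ≫ pushout.inr _ _, a₂, sq.desc (b₂ ≫ g) b' ?_, ?_, ?_, k₃, ?_⟩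
    · exact isCardinalPresentable_pushout _ _ hE hC₁ hD
    · rw [reassoc_of% k₄, h₂]
    · rw [reassoc_of% h₁, ← pushout.condition, reassoc_of% k₁]
    · rw [Category.assoc, sq.inl_desc, reassoc_of% k₂]
    · rw [Category.assoc, sq.inr_desc, h₄]

instance {J : Type w} [Category J] [EssentiallySmall.{v} J] [IsCardinalFiltered J κ] :
    (W.approximable κ).IsStableUnderColimitsOfShape J where
  condition X₁ X₂ c₁ c₂ h₁ h₂ f hf φ hφ := of_exists_factorization fun A B i hA hB a b h ↦ by
    have := isFiltered_of_isCardinalFiltered J κ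
    obtain ⟨j₁, a₁, ha₁⟩ := IsCardinalPresentable.exists_hom_of_isColimit κ h₁ a
    obtain ⟨j₂, b₁, hb₁⟩ := IsCardinalPresentable.exists_hom_of_isColimit κ h₂ b
    let m := IsFiltered.max j₁ j₂
    let a₂ : A ⟶ X₁.obj m := a₁ ≫ X₁.map (IsFiltered.leftToMax j₁ j₂)
    let b₂ : B ⟶ X₂.obj m := b₁ ≫ X₂.map (IsFiltered.rightToMax j₁ j₂)
    have ha₂ : a₂ ≫ c₁.ι.app m = a := by simp [a₂, m, ha₁]
    have hb₂ : b₂ ≫ c₂.ι.app m = b := by simp [b₂, m, hb₁]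
    clear_value a₂ b₂ m
    obtain ⟨k, u, hu⟩ := IsCardinalPresentable.exists_eq_of_isColimit' κ h₂
      (a₂ ≫ f.app m) (i ≫ b₂) (by
        rw [Category.assoc, ← hφ, reassoc_of% ha₂, Category.assoc, hb₂, h])
    obtain ⟨A', B', l, hl, hA', hB', α, β, a', b', e₁, e₂, e₃, e₄⟩ :=
      (hf k).exists_factorization (i := i) (a := a₂ ≫ X₁.map u) (b := b₂ ≫ X₂.map u) hA hB
        (by simpa using hu.symm)
    exact ⟨A', B', l, hl, hA', hB', α, β, a' ≫ c₁.ι.app k, b' ≫ c₂.ι.app k, e₁,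
      by simp [hφ, reassoc_of% e₂], by simp [reassoc_of% e₃, ha₂], by simp [reassoc_of% e₄, hb₂]⟩

end approximable

end MorphismProperty

end CategoryTheory

namespace CategoryTheory

variable {C : Type u} [Category.{v} C]

section

variable {J : Type w} [Category J] {F G H K : J ⥤ C} {l : F ⟶ G} {s : F ⟶ H}
  {i : G ⟶ K} {r : H ⟶ K}
  (hsq : ∀ j, IsPushout (l.app j) (s.app j) (i.app j) (r.app j))
  {cF : Cocone F} (hF : IsColimit cF) {cG : Cocone G} (hG : IsColimit cG)
  {cH : Cocone H} (hH : IsColimit cH) {P : C} {l' : cF.pt ⟶ cG.pt} {s' : cF.pt ⟶ cH.pt}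
  (hl : ∀ j, cF.ι.app j ≫ l' = l.app j ≫ cG.ι.app j)
  (hs : ∀ j, cF.ι.app j ≫ s' = s.app j ≫ cH.ι.app j)
  {t : cG.pt ⟶ P} {g : cH.pt ⟶ P} (sq : IsPushout l' s' t g)

include hsq hF hG hH hl hs sq in
/-- A pushout of colimits is a colimit of pushouts. -/
lemma exists_isColimit_of_isPushout :
    ∃ (ι : K ⟶ (Functor.const J).obj P), Nonempty (IsColimit (Cocone.mk P ι)) ∧
      ∀ j, cH.ι.app j ≫ g = r.app j ≫ ι.app j := by
  let ι' (j : J) : K.obj j ⟶ P := (hsq j).desc (cG.ι.app j ≫ t) (cH.ι.app j ≫ g) (by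
    rw [← reassoc_of% (hl j), ← reassoc_of% (hs j), sq.w])
  have hi (j : J) : i.app j ≫ ι' j = cG.ι.app j ≫ t := (hsq j).inl_desc _ _ _
  have hr (j : J) : r.app j ≫ ι' j = cH.ι.app j ≫ g := (hsq j).inr_desc _ _ _
  clear_value ι'
  let ι : K ⟶ (Functor.const J).obj P :=
    { app := ι'
      naturality j k u := (hsq j).hom_ext
        (by
          rw [← reassoc_of% (i.naturality u), hi, Cocone.w_assoc, ← hi]
          exact congr_arg _ (Category.comp_id (Y := P) _).symm)
        (by
          rw [← reassoc_of% (r.naturality u), hr, Cocone.w_assoc, ← hr]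
          exact congr_arg _ (Category.comp_id (Y := P) _).symm) }
  let dG (c : Cocone K) : cG.pt ⟶ c.pt := hG.desc ⟨c.pt, i ≫ c.ι⟩
  have hdG (c : Cocone K) (j : J) : cG.ι.app j ≫ dG c = i.app j ≫ c.ι.app j := hG.fac _ j
  let dH (c : Cocone K) : cH.pt ⟶ c.pt := hH.desc ⟨c.pt, r ≫ c.ι⟩
  have hdH (c : Cocone K) (j : J) : cH.ι.app j ≫ dH c = r.app j ≫ c.ι.app j := hH.fac _ j
  clear_value dG dH
  have hd (c : Cocone K) : l' ≫ dG c = s' ≫ dH c := hF.hom_ext fun j ↦ by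
    rw [reassoc_of% (hl j), reassoc_of% (hs j), hdG, hdH, reassoc_of% (hsq j).w]
  refine ⟨ι, ⟨{
    desc c := sq.desc (dG c) (dH c) (hd c)
    fac c j := (hsq j).hom_ext ?_ ?_
    uniq c m hm := sq.hom_ext (hG.hom_ext fun j ↦ ?_) (hH.hom_ext fun j ↦ ?_) }⟩,
      fun j ↦ (hr j).symm⟩
  · change i.app j ≫ ι' j ≫ _ = _
    rw [reassoc_of% (hi j), sq.inl_desc, hdG]
  · change r.app j ≫ ι' j ≫ _ = _
    rw [reassoc_of% (hr j), sq.inr_desc, hdH]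
  · rw [sq.inl_desc, hdG, ← hm j]
    exact (reassoc_of% (hi j)) m |>.symm
  · rw [sq.inr_desc, hdH, ← hm j]
    exact (reassoc_of% (hr j)) m |>.symm

end

namespace MorphismProperty.approximable

variable {κ : Cardinal.{v}} [Fact κ.IsRegular] [IsCardinalLocallyPresentable C κ]
  {W : MorphismProperty C}

lemma of_isPushout_of_isColimit {J : Type v} [SmallCategory J] [IsCardinalFiltered J κ]
    {F G H : J ⥤ C} (l : F ⟶ G) (s : F ⟶ H) {cF : Cocone F} (hF : IsColimit cF) {cG : Cocone G}
    (hG : IsColimit cG) {cH : Cocone H} (hH : IsColimit cH) {P : C} {l' : cF.pt ⟶ cG.pt}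
    {s' : cF.pt ⟶ cH.pt} (hl : ∀ j, cF.ι.app j ≫ l' = l.app j ≫ cG.ι.app j)
    (hs : ∀ j, cF.ι.app j ≫ s' = s.app j ≫ cH.ι.app j)
    {t : cG.pt ⟶ P} {g : cH.pt ⟶ P} (sq : IsPushout l' s' t g)
    (h : ∀ j ⦃Z : C⦄ (t' : G.obj j ⟶ Z) (g' : H.obj j ⟶ Z),
      IsPushout (l.app j) (s.app j) t' g' → W.approximable κ g') : W.approximable κ g := by
  have : HasColimits C := inferInstanceAs (HasColimitsOfSize.{v, v} C)
  have hsq (j : J) : IsPushout (l.app j) (s.app j) ((pushout.inl l s).app j)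
      ((pushout.inr l s).app j) :=
    (IsPushout.of_hasPushout l s).map ((evaluation J C).obj j)
  obtain ⟨ι, ⟨hι⟩, hg⟩ := exists_isColimit_of_isPushout hsq hF hG hH hl hs sq
  exact IsStableUnderColimitsOfShape.condition H (pushout l s) cH ⟨P, ι⟩ hH hι (pushout.inr l s)
    (fun j ↦ h j _ _ (hsq j)) g hg

variable [W.IsStableUnderCobaseChange]

lemma of_isPushout_of_isCardinalPresentable {A B X Y : C} {l : A ⟶ B} {s : A ⟶ X} {t : B ⟶ Y}
    {g : X ⟶ Y} (sq : IsPushout l s t g) (hl : W l) (hA : IsCardinalPresentable A κ)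
    (hB : IsCardinalPresentable B κ) : W.approximable κ g := by
  have : HasColimits C := inferInstanceAs (HasColimitsOfSize.{v, v} C)
  obtain ⟨J, _, _, ⟨p⟩⟩ := (isCardinalFilteredGenerator_isCardinalPresentable
    C κ).exists_colimitsOfShape X
  have hp (j : J) : IsCardinalPresentable (p.diag.obj j) κ := p.prop_diag_obj j
  have := isFiltered_of_isCardinalFiltered J κ
  obtain ⟨j₀, s₀, hs₀⟩ := IsCardinalPresentable.exists_hom_of_isColimit κ p.isColimit s
  have := isFiltered_of_isCardinalFiltered (Under j₀) κ
  have := IsFiltered.isConnected (Under j₀)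
  let s' : (Functor.const (Under j₀)).obj A ⟶ CategoryTheory.Under.forget j₀ ⋙ p.diag :=
    { app u := s₀ ≫ p.diag.map u.hom
      naturality u v φ := by
        have := p.diag.congr_map (CategoryTheory.Under.w φ)
        rw [p.diag.map_comp] at this
        simp [← this] }
  refine of_isPushout_of_isColimit ((Functor.const (Under j₀)).map l) s'
    (isColimitConstCocone (Under j₀) A) (isColimitConstCocone (Under j₀) B)
    ((Functor.Final.isColimitWhiskerEquiv (CategoryTheory.Under.forget j₀) _).symm p.isColimit)
    (l' := l) (s' := s) ?_ ?_ sq ?_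
  · intro j
    exact (Category.id_comp _).trans (Category.comp_id _).symm
  · intro j
    refine (Category.id_comp _).trans (hs₀.symm.trans ?_)
    exact ((s₀ ≫= p.cocone.w j.hom).symm.trans (Category.assoc _ _ _).symm :)
  · intro j Z t' g' sq'
    have : IsCardinalPresentable (pushout (((Functor.const (Under j₀)).map l).app j)
        (s'.app j)) κ := isCardinalPresentable_pushout _ _ hA hB (hp j.right)
    exact of_isCardinalPresentable (W.of_isPushout sq'.flip hl) (hp j.right)
      (isCardinalPresentable_of_iso sq'.isoPushout.symm κ)

instance : (W.approximable κ).IsStableUnderCobaseChange where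
  of_isPushout {X Y X' Y' f s g t} sq hf := by
    have : HasColimits C := inferInstanceAs (HasColimitsOfSize.{v, v} C)
    obtain ⟨J, _, _, p, hp⟩ := ObjectProperty.FactorsThrough.exists_colimitPresentation hf
    have := isFiltered_of_isCardinalFiltered J κ
    have := IsFiltered.isConnected J
    have hl := isColimitOfPreserves Arrow.leftFunc p.isColimit
    have hr := isColimitOfPreserves Arrow.rightFunc p.isColimit
    refine of_isPushout_of_isColimit (Functor.whiskerLeft p.diag Arrow.leftToRight)
      ((Arrow.leftFunc.mapCocone p.cocone).ι ≫ (Functor.const J).map s) hl hr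
      (isColimitConstCocone J X') (l' := f) (s' := s) ?_ ?_ sq.flip ?_
    · intro j
      exact CategoryTheory.Arrow.w (p.ι.app j)
    · intro j
      exact (Category.comp_id (Y := X') _).symm
    · intro j Z t' g' sq'
      have := (hp j).2
      obtain ⟨h₁, h₂⟩ := CategoryTheory.Arrow.isCardinalPresentable_left_and_right κ (p.diag.obj j)
      exact of_isPushout_of_isCardinalPresentable sq' (hp j).1 h₁ h₂

end MorphismProperty.approximable

end CategoryTheory

namespace CategoryTheory

variable {C : Type u} [Category.{v} C]

namespace MorphismProperty

section

variable {κ : Cardinal.{v}} [Fact κ.IsRegular] [IsCardinalLocallyPresentable C κ]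
  {I : MorphismProperty C}
  (hI : ∀ ⦃A B : C⦄ (i : A ⟶ B), I i → IsCardinalPresentable A κ ∧ IsCardinalPresentable B κ)

include hI in
lemma isCardinalForSmallObjectArgument [OrderBot κ.ord.ToType] [IsSmall.{v} I] :
    I.IsCardinalForSmallObjectArgument κ :=
  have : HasColimitsOfSize.{v, v} C := inferInstance
  { preservesColimit {A _ _ _} i hi _ hf :=
      have := (hI i hi).1
      have := preservesColimitsOfShape_of_isCardinalPresentable A κ κ.ord.ToType
      inferInstance }

end

section

open CoproductsFromFiniteFiltered

variable {S : Type w} {X : Discrete S ⥤ C} [HasFiniteCoproducts C]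

/-- The inclusion in a finite subcoproduct. -/
noncomputable def ιFinset (X : Discrete S ⥤ C) (T : Finset (Discrete S)) (s : Discrete S)
    (hs : s ∈ T) : X.obj s ⟶ (liftToFinsetObj X).obj T :=
  Limits.Sigma.ι (fun x : T ↦ X.obj x) ⟨s, hs⟩

lemma finset_hom_ext {T : Finset (Discrete S)} {Z : C} {f g : (liftToFinsetObj X).obj T ⟶ Z}
    (h : ∀ s hs, ιFinset X T s hs ≫ f = ιFinset X T s hs ≫ g) : f = g :=
  Limits.Sigma.hom_ext _ _ fun x ↦ h x.1 x.2

lemma ιFinset_map {T T' : Finset (Discrete S)} (φ : T ⟶ T') (s : Discrete S) (hs : s ∈ T) :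
    ιFinset X T s hs ≫ (liftToFinsetObj X).map φ = ιFinset X T' s (leOfHom φ hs) :=
  Limits.Sigma.ι_desc _ _

/-- The morphism from a finite subcoproduct induced by a cocone. -/
noncomputable def finsetDesc (c : Cocone X) (T : Finset (Discrete S)) :
    (liftToFinsetObj X).obj T ⟶ c.pt :=
  Limits.Sigma.desc fun x ↦ c.ι.app x.1

lemma ιFinset_finsetDesc (c : Cocone X) (T : Finset (Discrete S)) (s : Discrete S)
    (hs : s ∈ T) : ιFinset X T s hs ≫ finsetDesc c T = c.ι.app s :=
  Limits.Sigma.ι_desc _ _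

/-- The cocone given by the finite subcoproducts of a coproduct. -/
noncomputable def finsetCocone (c : Cocone X) : Cocone (liftToFinsetObj X) where
  pt := c.pt
  ι :=
    { app T := finsetDesc c T
      naturality T T' φ := finset_hom_ext fun s hs ↦ by
        rw [← Category.assoc, ιFinset_map, ιFinset_finsetDesc]
        refine (ιFinset_finsetDesc c T s hs).symm.trans ?_
        exact congr_arg _ (Category.comp_id (Y := c.pt) _).symm }

/-- A coproduct is the filtered colimit of its finite subcoproducts. -/
noncomputable def isColimitFinsetCocone {c : Cocone X} (hc : IsColimit c) :
    IsColimit (finsetCocone c) where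
  desc d := (hc.desc ⟨d.pt, Discrete.natTrans fun s ↦
    ιFinset X {s} s (by simp) ≫ d.ι.app {s}⟩ :)
  fac d T := finset_hom_ext fun s hs ↦ by
    have h : ({s} : Finset (Discrete S)) ≤ T := by simpa using hs
    change _ ≫ finsetDesc c T ≫ _ = _
    rw [← Category.assoc, ιFinset_finsetDesc, hc.fac]
    change _ ≫ d.ι.app {s} = _
    rw [← d.w (homOfLE h), ← Category.assoc, ιFinset_map]
  uniq d m hm := hc.hom_ext fun s ↦ by
    rw [hc.fac]
    change _ = _ ≫ d.ι.app {s}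
    rw [← hm, ← Category.assoc]
    exact congr_arg (· ≫ m) (ιFinset_finsetDesc c {s} s (by simp)).symm

/-- The morphism between finite subcoproducts. -/
noncomputable def finsetMapApp {Y : Discrete S ⥤ C} (f : X ⟶ Y) (T : Finset (Discrete S)) :
    (liftToFinsetObj X).obj T ⟶ (liftToFinsetObj Y).obj T :=
  Limits.Sigma.map fun x : T ↦ f.app x.1

lemma ιFinset_finsetMapApp {Y : Discrete S ⥤ C} (f : X ⟶ Y) (T : Finset (Discrete S))
    (s : Discrete S) (hs : s ∈ T) :
    ιFinset X T s hs ≫ finsetMapApp f T = f.app s ≫ ιFinset Y T s hs :=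
  Limits.Sigma.ι_map (fun x : T ↦ f.app x.1) ⟨s, hs⟩

/-- The natural transformation between the diagrams of finite subcoproducts. -/
noncomputable def finsetMap {Y : Discrete S ⥤ C} (f : X ⟶ Y) :
    liftToFinsetObj X ⟶ liftToFinsetObj Y where
  app T := finsetMapApp f T
  naturality T T' φ := finset_hom_ext fun s hs ↦ by
    rw [← Category.assoc, ιFinset_map, ιFinset_finsetMapApp, ← Category.assoc,
      ιFinset_finsetMapApp, Category.assoc, ιFinset_map]

variable {κ : Cardinal.{v}} [Fact κ.IsRegular]

lemma isCardinalPresentable_liftToFinsetObj_obj (hX : ∀ s, IsCardinalPresentable (X.obj s) κ)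
    (T : Finset (Discrete S)) : IsCardinalPresentable ((liftToFinsetObj X).obj T) κ :=
  have (k : Discrete T) : IsCardinalPresentable
    ((Discrete.functor fun x : T ↦ X.obj x).obj k) κ := hX k.as.1
  isCardinalPresentable_of_isColimit _ (colimit.isColimit (Discrete.functor fun x : T ↦ X.obj x)) κ
    (hasCardinalLT_of_finite _ _ (Cardinal.IsRegular.aleph0_le Fact.out))

end

section

variable [Fact (Cardinal.aleph0.{v}).IsRegular]
  [IsCardinalLocallyPresentable C Cardinal.aleph0.{v}] {I : MorphismProperty C}
  (hI : ∀ ⦃A B : C⦄ (i : A ⟶ B), I i → IsCardinalPresentable A Cardinal.aleph0.{v} ∧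
    IsCardinalPresentable B Cardinal.aleph0.{v})

include hI

lemma coproducts_le_approximable :
    coproducts.{v} I ≤ I.rlp.llp.approximable Cardinal.aleph0.{v} := by
  classical
  have : HasColimits C := inferInstanceAs (HasColimitsOfSize.{v, v} C)
  intro A B g hg
  obtain ⟨S, hS⟩ := (coproducts_iff _ _).1 hg
  obtain ⟨X, Y, c, d, hc, hd, f, hf⟩ := hS
  have : IsCardinalFiltered (Finset (Discrete S)) Cardinal.aleph0.{v} :=
    (isCardinalFiltered_aleph0_iff _).2 inferInstance
  refine IsStableUnderColimitsOfShape.condition (J := Finset (Discrete S)) _ _ _ _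
    (isColimitFinsetCocone hc) (isColimitFinsetCocone hd) (finsetMap f) (fun T ↦ ?_) _
    (fun T ↦ finset_hom_ext fun s hs ↦ ?_)
  · refine approximable.of_isCardinalPresentable ?_
      (isCardinalPresentable_liftToFinsetObj_obj (fun s ↦ (hI _ (hf s)).1) T)
      (isCardinalPresentable_liftToFinsetObj_obj (fun s ↦ (hI _ (hf s)).2) T)
    exact MorphismProperty.colimMap _ fun ⟨x⟩ ↦ le_llp_rlp _ _ (hf x.1)
  · change _ ≫ finsetDesc c T ≫ _ = _ ≫ finsetMapApp f T ≫ finsetDesc d T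
    rw [← Category.assoc, ιFinset_finsetDesc, hc.fac, ← Category.assoc, ιFinset_finsetMapApp,
      Category.assoc, ιFinset_finsetDesc]
    rfl

lemma llp_rlp_le_approximable_aleph0 [IsSmall.{v} I] :
    I.rlp.llp ≤ I.rlp.llp.approximable Cardinal.aleph0.{v} := by
  let := Cardinal.orderBotAleph0OrdToType.{v}
  have := isCardinalForSmallObjectArgument hI
  have : IsStableUnderFilteredColimits.{0, 0} (I.rlp.llp.approximable Cardinal.aleph0.{v}) :=
    ⟨fun J _ _ ↦ by
      have : IsCardinalFiltered J Cardinal.aleph0.{v} :=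
        (isCardinalFiltered_aleph0_iff J).2 inferInstance
      infer_instance⟩
  refine (SmallObject.llp_rlp_of_isCardinalForSmallObjectArgument_aleph0 I).le.trans ?_
  exact (retracts_monotone ((transfiniteCompositionsOfShape_monotone ℕ
    (pushouts_le_iff.2 (coproducts_le_approximable hI))).trans
      (transfiniteCompositionsOfShape_le _ _))).trans (retracts_le _)

end

end MorphismProperty

end CategoryTheory

namespace CategoryTheory.MorphismProperty

variable {C : Type u} [Category.{v} C]

/-- In a locally `κ`-presentable category, a morphism in the class cofibrantly generated by a set
`I` of morphisms between `κ`-presentable objects is, in the arrow category, a `κ`-directed colimit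
of morphisms in this class between `κ`-presentable objects. -/
lemma exists_colimitPresentation_of_llp_rlp {κ : Cardinal.{v}} [Fact κ.IsRegular]
    [IsCardinalLocallyPresentable C κ] {I : MorphismProperty C} [IsSmall.{v} I]
    (hI : ∀ ⦃A B : C⦄ (i : A ⟶ B), I i → IsCardinalPresentable A κ ∧ IsCardinalPresentable B κ)
    {X Y : C} (f : X ⟶ Y) (hf : I.rlp.llp f) :
    ∃ (α : Type v) (_ : PartialOrder α) (_ : IsCardinalFiltered α κ)
      (p : ColimitPresentation α (CategoryTheory.Arrow.mk f)),
      ∀ a, I.rlp.llp (p.diag.obj a).hom ∧ IsCardinalPresentable (p.diag.obj a).left κ ∧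
        IsCardinalPresentable (p.diag.obj a).right κ := by
  have h : I.rlp.llp.arrowProp.FactorsThrough κ (CategoryTheory.Arrow.mk f) := by
    obtain h | rfl := (Cardinal.IsRegular.aleph0_le (Fact.out : κ.IsRegular)).lt_or_eq
    · have : Nonempty κ.ord.ToType := by simpa using Cardinal.IsRegular.ne_zero Fact.out
      let := WellFoundedLT.toOrderBot κ.ord.ToType
      have := isCardinalForSmallObjectArgument hI
      exact factorsThrough_llp_rlp_of_aleph0_lt h hI (SmallObject.functorialFactorizationData I κ)
        hf
    · exact llp_rlp_le_approximable_aleph0 hI _ hf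
  obtain ⟨α, _, _, p, hp⟩ := h.exists_colimitPresentation
  refine ⟨α, inferInstance, inferInstance, p, fun a ↦ ⟨(hp a).1, ?_⟩⟩
  have := (hp a).2
  exact CategoryTheory.Arrow.isCardinalPresentable_left_and_right κ _

end CategoryTheory.MorphismProperty

namespace PaperAcc

variable {M : Type u} [Category.{v} M] {κ : Cardinal.{v}} [Fact κ.IsRegular]

lemma isCardinalFiltered_iff (J : Type v) [SmallCategory J] :
    IsCardinalFiltered J κ ↔ CategoryTheory.IsCardinalFiltered J κ :=
  ⟨fun h ↦ ⟨fun F hA ↦ h _ ((hasCardinalLT_iff_cardinal_mk_lt _ _).1 hA) F⟩,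
    fun h _ _ hA F ↦ h.nonempty_cocone F ((hasCardinalLT_iff_cardinal_mk_lt _ _).2 hA)⟩

lemma isPresentable_iff (X : M) : IsPresentable κ X ↔ IsCardinalPresentable X κ :=
  ⟨fun h ↦ ⟨fun J _ _ ↦ (h J ((isCardinalFiltered_iff J).2 inferInstance)).some⟩,
    fun _ J _ hJ ↦
      have := (isCardinalFiltered_iff J).1 hJ
      ⟨preservesColimitsOfShape_of_isCardinalPresentable X κ J⟩⟩

lemma isCardinalDirected_of_isCardinalFiltered (P : Type v) [Preorder P]
    [CategoryTheory.IsCardinalFiltered P κ] : IsCardinalDirected P κ :=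
  fun S hS ↦
    have hS : HasCardinalLT S κ := (hasCardinalLT_iff_cardinal_mk_lt _ _).2 hS
    ⟨CategoryTheory.IsCardinalFiltered.max (fun s : S ↦ s.1) hS, fun s hs ↦
      leOfHom (CategoryTheory.IsCardinalFiltered.toMax (fun s : S ↦ s.1) hS ⟨s, hs⟩)⟩

lemma IsLocallyPresentable.isCardinalLocallyPresentable (h : IsLocallyPresentable M κ) :
    IsCardinalLocallyPresentable M κ := by
  obtain ⟨_, ι, G, hG, hX⟩ := h
  have hP : (ObjectProperty.ofObj G).IsCardinalFilteredGenerator κ :=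
    { le_isCardinalPresentable := by
        rintro _ ⟨i⟩
        exact (isPresentable_iff _).1 (hG i)
      exists_colimitsOfShape X := by
        obtain ⟨p⟩ := hX X
        let := p.instJ
        refine ⟨p.J, p.instJ, (isCardinalFiltered_iff p.J).1 p.filtered,
          ObjectProperty.prop_of_iso _ p.iso ⟨⟨⟨p.F, p.c.ι, p.isColimit⟩, fun j ↦ ?_⟩⟩⟩
        obtain ⟨i, hi⟩ := p.mem j
        rw [← hi]
        exact ObjectProperty.ofObj_apply _ _ }
  have := hP.hasCardinalFilteredGenerator
  exact { }

lemma llp_rlpOf {ι : Type w} {A B : ι → M} (f : ∀ i, A i ⟶ B i) :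
    Llp (RlpOf f) = (MorphismProperty.ofHoms f).rlp.llp := by
  have : RlpOf f = (MorphismProperty.ofHoms f).rlp := by
    ext X Y g
    exact ⟨fun h _ _ _ ⟨i⟩ ↦ h i, fun h i ↦ h _ ⟨i⟩⟩
  rw [this]
  rfl

end PaperAcc

namespace PaperAcc

/-- Corollary 3.3. Let `M` be a `κ`-combinatorial model category. Then every
trivial cofibration in `M` is a `κ`-directed colimit, taken in the arrow category `M^→`, of
trivial cofibrations between `κ`-presentable objects. -/
theorem statement2 {M : Type u} [Category.{v} M] (κ : Cardinal.{v})
    (S : ModelStructure M) (hcomb : IsCombinatorial S κ)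
    {X Y : M} (f : X ⟶ Y) (hcof : S.Cof f) (hw : S.W f) :
    Nonempty (DirectedColimitPresentation (M := Arrow M) κ
      (PresentableArrowsIn κ {a : Arrow M | S.Cof a.hom ∧ S.W a.hom}) (Arrow.mk f)) := by
  have : Fact κ.IsRegular := ⟨hcomb.isRegular⟩
  have := hcomb.locallyPresentable.isCardinalLocallyPresentable
  obtain ⟨ι, A, B, g, hA, hB, h⟩ := hcomb.trivCofGenerated
  rw [llp_rlpOf] at h
  have hI ⦃A' B' : M⦄ (i : A' ⟶ B') (hi : MorphismProperty.ofHoms g i) :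
      IsCardinalPresentable A' κ ∧ IsCardinalPresentable B' κ := by
    obtain ⟨i⟩ := hi
    exact ⟨(isPresentable_iff _).1 (hA i), (isPresentable_iff _).1 (hB i)⟩
  have hf : (S.Cof ⊓ S.W) f := ⟨hcof, hw⟩
  rw [h] at hf
  obtain ⟨α, _, _, p, hp⟩ := MorphismProperty.exists_colimitPresentation_of_llp_rlp hI f hf
  rw [← h] at hp
  exact ⟨{
    J := α
    directed := isCardinalDirected_of_isCardinalFiltered α
    F := p.diag
    mem a := ⟨(hp a).1, (isPresentable_iff _).2 (hp a).2.1, (isPresentable_iff _).2 (hp a).2.2⟩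
    c := p.cocone
    isColimit := p.isColimit
    iso := Iso.refl _ }⟩

end PaperAcc
end

section
/- Let M be a combinatorial model category (a locally presentable, cofibrantly generated model category) admitting a generating set I of cofibrations consisting of morphisms between κ-presentable objects, for some regular cardinal κ. Then the class of weak equivalences of M is closed under κ-filtered colimits in the arrow category M^→. -/
open CategoryTheory CategoryTheory.Limits

universe w v u

namespace PaperAcc

section Presentable

variable {κ : Cardinal.{v}} [Fact κ.IsRegular]

lemma isCardinalFiltered_iff_mathlib {J : Type v} [SmallCategory J] :
    IsCardinalFiltered J κ ↔ CategoryTheory.IsCardinalFiltered J κ := by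
  refine ⟨fun h ↦ ⟨fun {A} _ F hA ↦ h A ?_ F⟩, fun h A _ hA F ↦ h.nonempty_cocone F ?_⟩
  · exact (hasCardinalLT_iff_cardinal_mk_lt _ _).1 hA
  · exact (hasCardinalLT_iff_cardinal_mk_lt _ _).2 hA

lemma IsPresentable.isCardinalPresentable {M : Type u} [Category.{v} M] {X : M}
    (hX : IsPresentable κ X) : IsCardinalPresentable X κ where
  preservesColimitOfShape J _ hJ := (hX J (isCardinalFiltered_iff_mathlib.2 hJ)).some

/-- Morphisms between `κ`-presentable objects have the left lifting property with respect to
`κ`-filtered colimits of morphisms for which they have the left lifting property. -/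
lemma hasLiftingProperty_of_isColimit {M : Type u} [Category.{v} M] {J : Type v} [SmallCategory J]
    [CategoryTheory.IsCardinalFiltered J κ] {A B : M} (g : A ⟶ B)
    [IsCardinalPresentable A κ] [IsCardinalPresentable B κ] {Z Y : J ⥤ M} (p : Z ⟶ Y)
    (hp : ∀ j, HasLiftingProperty g (p.app j)) {cZ : Cocone Z} (hZ : IsColimit cZ)
    {cY : Cocone Y} (hY : IsColimit cY) (φ : cZ.pt ⟶ cY.pt)
    (hφ : ∀ j, cZ.ι.app j ≫ φ = p.app j ≫ cY.ι.app j) :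
    HasLiftingProperty g φ where
  sq_hasLift {a b} sq := by
    obtain ⟨j₁, a', ha'⟩ := IsCardinalPresentable.exists_hom_of_isColimit κ hZ a
    obtain ⟨j₂, b', hb'⟩ := IsCardinalPresentable.exists_hom_of_isColimit κ hY b
    obtain ⟨j, u, w, h⟩ := IsCardinalPresentable.exists_eq_of_isColimit κ hY
      (a' ≫ p.app j₁) (g ≫ b') (by
        rw [Category.assoc, Category.assoc, hb', ← hφ, reassoc_of% ha', sq.w])
    have sq' : CommSq (a' ≫ Z.map u) g (p.app j) (b' ≫ Y.map w) :=
      ⟨by simpa using h⟩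
    have := hp j
    exact ⟨⟨{
      l := sq'.lift ≫ cZ.ι.app j
      fac_left := by rw [sq'.fac_left_assoc, Category.assoc, cZ.w, ha']
      fac_right := by
        rw [Category.assoc, hφ, sq'.fac_right_assoc, Category.assoc, cY.w, hb'] }⟩⟩

end Presentable

section Projective

open MorphismProperty

variable {M : Type u} [Category.{v} M]

lemma rlp_ofHoms {ι : Type v} {A B : ι → M} (g : ∀ i, A i ⟶ B i) :
    (ofHoms g).rlp = RlpOf g := by
  ext X Y p
  exact ⟨fun h i ↦ h _ ⟨i⟩, by rintro h _ _ _ ⟨i⟩; exact h i⟩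

/-- A set of morphisms with `κ`-presentable domains permits the small object argument. -/
lemma hasSmallObjectArgument_of_isCardinalPresentable [HasColimitsOfSize.{v, v} M]
    (κ : Cardinal.{v}) [Fact κ.IsRegular] (I : MorphismProperty M) [IsSmall.{v} I]
    (hI : ∀ ⦃A B : M⦄ (g : A ⟶ B), I g → IsCardinalPresentable A κ) :
    HasSmallObjectArgument.{v} I where
  exists_cardinal := by
    have : Nonempty κ.ord.ToType := by simpa using Cardinal.IsRegular.ne_zero Fact.out
    have := WellFoundedLT.toOrderBot κ.ord.ToType
    exact ⟨κ, inferInstance, inferInstance, {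
      preservesColimit {A _ _ _} g hg _ _ := by
        have := hI g hg
        have := preservesColimitsOfShape_of_isCardinalPresentable A κ κ.ord.ToType
        infer_instance }⟩

variable [HasColimitsOfSize.{v, v} M] (J : Type v) [SmallCategory J]
  {ι : Type v} {A B : ι → M} (g : ∀ i, A i ⟶ B i)

/-- The generating morphisms of the projective weak factorization system on `J ⥤ M`: the images
of the morphisms `g i` under the left adjoints of the evaluation functors. -/
noncomputable def projectiveGenerators : MorphismProperty (J ⥤ M) :=
  ofHoms fun (x : J × ι) ↦ (evaluationLeftAdjoint M x.1).map (g x.2)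

variable {J}

lemma projectiveGenerators_rlp_iff {Z Y : J ⥤ M} (p : Z ⟶ Y) :
    (projectiveGenerators J g).rlp p ↔ ∀ j, RlpOf g (p.app j) := by
  have h (j : J) (i : ι) := (evaluationAdjunctionRight M j).hasLiftingProperty_iff (g i) p
  refine ⟨fun hp j i ↦ (h j i).1 (hp _ ⟨(⟨j, i⟩ : J × ι)⟩), ?_⟩
  rintro hp _ _ _ ⟨j, i⟩
  exact (h j i).2 (hp j i)

lemma projectiveGenerators_le_functorCategory :
    projectiveGenerators J g ≤ (ofHoms g).rlp.llp.functorCategory J := by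
  rintro _ _ _ ⟨j, i⟩ t X Y p hp
  have e : (Limits.Sigma.desc fun (h : j ⟶ t) ↦ g i ≫ Sigma.ι (fun _ ↦ B i) h) =
      Limits.Sigma.map (fun (_ : j ⟶ t) ↦ g i) :=
    Limits.Sigma.hom_ext _ _ fun _ ↦ by simp
  have (_ : j ⟶ t) : HasLiftingProperty (g i) p := hp _ ⟨i⟩
  have hlift : HasLiftingProperty (Limits.Sigma.map fun (_ : j ⟶ t) ↦ g i) p := inferInstance
  rw [← e] at hlift
  exact hlift

variable (κ : Cardinal.{v}) [Fact κ.IsRegular]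

lemma hasSmallObjectArgument_projectiveGenerators
    (hA : ∀ i, IsCardinalPresentable (A i) κ) :
    HasSmallObjectArgument.{v} (projectiveGenerators J g) := by
  have : IsSmall.{v} (projectiveGenerators J g) := by
    unfold projectiveGenerators; infer_instance
  refine hasSmallObjectArgument_of_isCardinalPresentable κ _ ?_
  rintro _ _ _ ⟨j, i⟩
  have := hA i
  exact (evaluationAdjunctionRight M j).isCardinalPresentable_leftAdjoint_obj κ (A i)

lemma projectiveGenerators_rlp_llp_le_functorCategory
    (hA : ∀ i, IsCardinalPresentable (A i) κ) :
    (projectiveGenerators J g).rlp.llp ≤ (ofHoms g).rlp.llp.functorCategory J := by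
  have := hasSmallObjectArgument_projectiveGenerators (J := J) g κ hA
  have : IsStableUnderCoproducts.{v} ((ofHoms g).rlp.llp.functorCategory J) := { }
  have : IsStableUnderTransfiniteComposition.{v} ((ofHoms g).rlp.llp.functorCategory J) := { }
  have h : (coproducts.{v} (projectiveGenerators J g)).pushouts ≤
      (ofHoms g).rlp.llp.functorCategory J :=
    (pushouts_monotone ((coproducts_monotone (projectiveGenerators_le_functorCategory g)).trans
      (coproducts_le _))).trans pushouts_le
  rw [llp_rlp_of_hasSmallObjectArgument]
  refine (retracts_monotone ?_).trans (retracts_le _)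
  exact (transfiniteCompositions_monotone h).trans (transfiniteCompositions_le _)

/-- A natural transformation `α` factors as `i ≫ p`, where `i` is objectwise in `llp (rlp g)`
and `p` is objectwise in `rlp g`, in such a way that the induced factorization `ψ ≫ q` of a
colimit of `α` also starts with a morphism in `llp (rlp g)`. -/
lemma exists_projective_factorization (hA : ∀ i, IsCardinalPresentable (A i) κ) {X Y : J ⥤ M}
    (α : X ⟶ Y) {cX : Cocone X} (hX : IsColimit cX) (cY : Cocone Y) (φ : cX.pt ⟶ cY.pt)
    (hφ : ∀ j, cX.ι.app j ≫ φ = α.app j ≫ cY.ι.app j) :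
    ∃ (Z : J ⥤ M) (i : X ⟶ Z) (p : Z ⟶ Y) (ψ : cX.pt ⟶ colimit Z) (q : colimit Z ⟶ cY.pt),
      i ≫ p = α ∧ ψ ≫ q = φ ∧ (∀ j, colimit.ι Z j ≫ q = p.app j ≫ cY.ι.app j) ∧
      (∀ j, (ofHoms g).rlp.llp (i.app j)) ∧ (ofHoms g).rlp.llp ψ ∧ ∀ j, RlpOf g (p.app j) := by
  have := hasSmallObjectArgument_projectiveGenerators (J := J) g κ hA
  have h := factorizationData (projectiveGenerators J g).rlp.llp (projectiveGenerators J g).rlp α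
  let e := hX.coconePointUniqueUpToIso (colimit.isColimit X)
  have he (j : J) : cX.ι.app j ≫ e.hom = colimit.ι X j :=
    hX.comp_coconePointUniqueUpToIso_hom _ j
  refine ⟨h.Z, h.i, h.p, e.hom ≫ colim.map h.i,
    colimit.desc h.Z ((Cocone.precompose h.p).obj cY), h.fac, ?_, fun j ↦ by simp,
    fun j ↦ projectiveGenerators_rlp_llp_le_functorCategory g κ hA _ h.hi j, ?_,
    (projectiveGenerators_rlp_iff g _).1 h.hp⟩
  · refine hX.hom_ext fun j ↦ ?_
    simp [reassoc_of% (he j), hφ]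
  · rw [cancel_left_of_respectsIso (ofHoms g).rlp.llp]
    intro _ _ q hq
    rw [colimConstAdj.hasLiftingProperty_iff]
    refine h.hi _ ((projectiveGenerators_rlp_iff g _).2 fun j ↦ ?_)
    rw [rlp_ofHoms] at hq
    exact hq

end Projective

lemma ModelStructure.fib_of_rlp {M : Type u} [Category.{v} M] (S : ModelStructure M) {X Y : M}
    (p : X ⟶ Y) (hp : (S.Cof ⊓ S.W).rlp p) : S.Fib p := by
  obtain ⟨Z, i, q, hi, hi', hq, fac⟩ := S.fact_trivCof_fib p
  have := hp i ⟨hi, hi'⟩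
  have sq : CommSq (𝟙 X) i p q := ⟨by simp [fac]⟩
  exact S.Fib_retract p q i sq.lift (𝟙 Y) (𝟙 Y) sq.fac_left (by simp) (by simp [fac])
    (by simp [sq.fac_right]) hq

/-- Proposition 4.1. Let `M` be a combinatorial model category admitting a
generating set `I` of cofibrations consisting of morphisms between `κ`-presentable objects
(i.e. the trivial fibrations are exactly the morphisms with the right lifting property against
`I`), for a regular cardinal `κ`. Then the class of weak equivalences of `M` is closed under
`κ`-filtered colimits in the arrow category `M^→`. -/
theorem statement4 {M : Type u} [Category.{v} M] (S : ModelStructure M)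
    (hcomb : ∃ μ : Cardinal.{v}, IsCombinatorial S μ)
    (κ : Cardinal.{v}) (hκ : κ.IsRegular)
    (ι : Type v) (A B : ι → M) (f : ∀ i, A i ⟶ B i)
    (hA : ∀ i, IsPresentable κ (A i)) (hB : ∀ i, IsPresentable κ (B i))
    (hcof : ∀ i, S.Cof (f i))
    (hgen : S.Fib ⊓ S.W = RlpOf f) :
    ClosedUnderFilteredColimits κ {a : Arrow M | S.W a.hom} := by
  intro J _ hJ F c hc hF
  obtain ⟨μ, hμ⟩ := hcomb
  have : Fact κ.IsRegular := ⟨hκ⟩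
  have : Fact μ.IsRegular := ⟨hμ.isRegular⟩
  have := hμ.locallyPresentable.1
  have := isCardinalFiltered_iff_mathlib.1 hJ
  obtain ⟨ι', A', B', g, hA', -, hg⟩ := hμ.trivCofGenerated
  have hg : S.Cof ⊓ S.W = (MorphismProperty.ofHoms g).rlp.llp := by
    rw [rlp_ofHoms, hg]
    rfl
  have hX := isColimitOfPreserves Arrow.leftFunc hc
  have hY := isColimitOfPreserves Arrow.rightFunc hc
  obtain ⟨Z, i, p, ψ, q, fac, fac', hq, hi, hψ, hp⟩ := exists_projective_factorization g μ
    (fun k ↦ (hA' k).isCardinalPresentable) (Functor.whiskerLeft F Arrow.leftToRight) hX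
    (Arrow.rightFunc.mapCocone c) c.pt.hom (fun j ↦ Arrow.w (c.ι.app j))
  have hp' (j : J) : RlpOf f (p.app j) := by
    rw [← hgen]
    refine ⟨S.fib_of_rlp _ ?_, ?_⟩
    · rw [hg, MorphismProperty.rlp_llp_rlp, rlp_ofHoms]
      exact hp j
    · have hij := hi j
      rw [← hg] at hij
      have fac_app : i.app j ≫ p.app j = (F.obj j).hom := congr_app fac j
      exact S.W_of_comp_left _ _ hij.2 (by rw [fac_app]; exact hF j)
  have hq' : (S.Fib ⊓ S.W) q := by
    rw [hgen]
    intro k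
    have := (hA k).isCardinalPresentable
    have := (hB k).isCardinalPresentable
    exact hasLiftingProperty_of_isColimit (κ := κ) (f k) p (fun j ↦ hp' j k)
      (colimit.isColimit Z) hY q hq
  rw [← hg] at hψ
  change S.W c.pt.hom
  rw [← fac']
  exact S.W_comp _ _ hψ.2 hq'.2

end PaperAcc
end
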